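/- arXiv:gr-qc/9412036 — 2 statements merged into one kernel-verified Lean document; each statement's English description precedes it below -/
import Mathlib

section
/- Let B = B_R ⊂ ℝⁿ be the open ball of radius R centered at the origin, and let Σ be a smooth closed submanifold of ℝⁿ of codimension at least 2. If u ∈ C^∞(closure(B) \ Σ) satisfies Δu ≥ 0 and 0 ≤ u ≤ 1 on B \ Σ, then for any R' < R one has ∫_{B_{R'}} |∇u|² ≤ C, where C depends only on R, R', and n. -/
/-!
STATEMENT 0: Energy bound for bounded subharmonic functions with a
codimension-≥-2 singular set (Lemma 8, first part, of the paper).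
-/

open MeasureTheory Metric

noncomputable section

abbrev E (n : ℕ) := EuclideanSpace ℝ (Fin n)

/-- The Euclidean Laplacian `Δf(x) = ∑ᵢ ∂²f/∂xᵢ²`. -/
noncomputable def elaplacian {n : ℕ} (f : E n → ℝ) (x : E n) : ℝ :=
  ∑ i, fderiv ℝ (fun y => fderiv ℝ f y (EuclideanSpace.single i (1 : ℝ))) x
    (EuclideanSpace.single i (1 : ℝ))

/-- `S` is a smooth closed submanifold of `ℝⁿ` of codimension at least 2
(possibly with boundary): near each of its points it is the image of an open
set (or a half-open set) of `ℝᵈ`, `d + 2 ≤ n`, under a smooth injective map. -/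
def IsClosedSubmanifoldCodimGe2 {n : ℕ} (S : Set (E n)) : Prop :=
  IsClosed S ∧ ∃ d : ℕ, d + 2 ≤ n ∧ ∀ x ∈ S,
    ∃ (V : Set (E d)) (f : E d → E n) (U : Set (E n)),
      IsOpen V ∧ IsOpen U ∧ x ∈ U ∧ ContDiffOn ℝ (⊤ : ℕ∞) f V ∧ Set.InjOn f V ∧
      (f '' V = S ∩ U ∨ ∃ i : Fin d, f '' {y ∈ V | 0 ≤ y i} = S ∩ U)

open scoped NNReal ENNReal

lemma exists_lipschitzWith_mul {X : Type*} [PseudoMetricSpace X] {f g : X → ℝ} {A B : ℝ}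
    {K L : ℝ≥0} (hf : LipschitzWith K f) (hg : LipschitzWith L g)
    (hfA : ∀ x, |f x| ≤ A) (hgB : ∀ x, |g x| ≤ B) :
    ∃ C, LipschitzWith C (fun x => f x * g x) := by
  refine ⟨Real.toNNReal (A * L + B * K), LipschitzWith.of_dist_le' fun x y => ?_⟩
  have h1 := hf.dist_le_mul x y
  have h2 := hg.dist_le_mul x y
  rw [Real.dist_eq] at *
  calc |f x * g x - f y * g y| = |f x * (g x - g y) + g y * (f x - f y)| := by ring_nf
    _ ≤ |f x| * |g x - g y| + |g y| * |f x - f y| := by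
      rw [← abs_mul, ← abs_mul]; exact abs_add_le _ _
    _ ≤ A * (L * dist x y) + B * (K * dist x y) := by
      gcongr
      · exact (abs_nonneg _).trans (hfA x)
      · exact hfA x
      · exact (abs_nonneg _).trans (hgB y)
      · exact hgB y
    _ = (A * L + B * K) * dist x y := by ring

lemma norm_sq_eq_sum_apply_single {n : ℕ} (L : E n →L[ℝ] ℝ) :
    ‖L‖ ^ 2 = ∑ i, L (EuclideanSpace.single i 1) ^ 2 := by
  rw [← (InnerProductSpace.toDual ℝ (E n)).symm.norm_map L, EuclideanSpace.norm_sq_eq]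
  refine Finset.sum_congr rfl fun i _ => ?_
  rw [Real.norm_eq_abs, sq_abs, ← InnerProductSpace.toDual_symm_apply,
    EuclideanSpace.inner_single_right]
  simp

lemma integrable_fderiv_apply_sq {n : ℕ} {ψ : E n → ℝ} {K : ℝ≥0} (hψ : LipschitzWith K ψ)
    (hψc : HasCompactSupport ψ) (e : E n) :
    Integrable (fun x => fderiv ℝ ψ x e ^ 2) := by
  have hs : Function.support (fun x => fderiv ℝ ψ x e ^ 2) ⊆ tsupport ψ := by
    intro x hx
    apply support_fderiv_subset ℝ
    rw [Function.mem_support] at hx ⊢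
    contrapose! hx
    simp [hx]
  rw [← integrableOn_iff_integrable_of_support_subset hs]
  refine Measure.integrableOn_of_bounded (M := (K * ‖e‖) ^ 2) hψc.measure_lt_top.ne
    (by measurability) (ae_of_all _ fun x => ?_)
  rw [norm_pow]
  gcongr
  exact ((fderiv ℝ ψ x).le_opNorm e).trans
    (by gcongr; exact norm_fderiv_le_of_lipschitz ℝ hψ)

lemma integral_sq_mul_norm_fderiv_sq_le {n : ℕ} {v ψ : E n → ℝ} (hv : ContDiff ℝ 2 v)
    (hvc : HasCompactSupport v) {K : ℝ≥0} (hψ : LipschitzWith K ψ) (hψc : HasCompactSupport ψ)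
    (hΔ : ∀ x, ψ x ≠ 0 → 0 ≤ elaplacian v x) (hb : ∀ x, ψ x ≠ 0 → 0 ≤ v x ∧ v x ≤ 1) :
    Integrable (fun x => ψ x ^ 2 * ‖fderiv ℝ v x‖ ^ 2) ∧
    Integrable (fun x => ‖fderiv ℝ ψ x‖ ^ 2) ∧
    ∫ x, ψ x ^ 2 * ‖fderiv ℝ v x‖ ^ 2 ≤ 4 * ∫ x, ‖fderiv ℝ ψ x‖ ^ 2 := by
  set e : Fin n → E n := fun i => EuclideanSpace.single i 1 with he
  set w : Fin n → E n → ℝ := fun i x => fderiv ℝ v x (e i) with hw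
  have hw1 : ∀ i, ContDiff ℝ 1 (w i) := fun i =>
    (hv.fderiv_right (m := 1) (by norm_num)).clm_apply contDiff_const
  have hwc : ∀ i, HasCompactSupport (w i) := fun i => hvc.fderiv_apply ℝ (e i)
  have hψcont := hψ.continuous
  have hvcont := hv.continuous
  have hwcont := fun i => (hw1 i).continuous
  obtain ⟨Kv, hKv⟩ := hv.lipschitzWith_of_hasCompactSupport hvc (by norm_num)
  obtain ⟨A, hA⟩ := hψc.exists_bound_of_continuous hψcont
  obtain ⟨B, hB⟩ := hvc.exists_bound_of_continuous hvcont
  simp only [Real.norm_eq_abs] at hA hB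
  obtain ⟨K1, hK1⟩ := exists_lipschitzWith_mul hψ hKv hA hB
  obtain ⟨K2, hK2⟩ := exists_lipschitzWith_mul (B := A * B) hψ hK1 hA
    (fun x => by rw [abs_mul]; exact mul_le_mul (hA x) (hB x) (abs_nonneg _)
                  ((abs_nonneg _).trans (hA x)))
  have hgc : HasCompactSupport (fun x => ψ x * (ψ x * v x)) := hψc.mul_right
  have iA : ∀ i, Integrable (fun x => ψ x ^ 2 * w i x ^ 2) := fun i => by
    refine Continuous.integrable_of_hasCompactSupport (by fun_prop) ?_
    simp only [sq, mul_assoc]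
    exact hψc.mul_right
  have iB : ∀ i, Integrable (fun x => fderiv ℝ ψ x (e i) ^ 2) := fun i =>
    integrable_fderiv_apply_sq hψ hψc _
  have iL : ∀ i, Integrable (fun x => fderiv ℝ (w i) x (e i) * (ψ x * (ψ x * v x))) := fun i => by
    have : Continuous fun x => fderiv ℝ (w i) x (e i) :=
      ((hw1 i).continuous_fderiv (by norm_num)).clm_apply continuous_const
    exact Continuous.integrable_of_hasCompactSupport (by fun_prop) hgc.mul_left
  have key : ∀ i, ∫ x, ψ x ^ 2 * w i x ^ 2 ≤ 4 * (∫ x, fderiv ℝ ψ x (e i) ^ 2)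
      - 2 * ∫ x, fderiv ℝ (w i) x (e i) * (ψ x * (ψ x * v x)) := by
    intro i
    obtain ⟨Kw, hKw⟩ := (hw1 i).lipschitzWith_of_hasCompactSupport (hwc i) (by norm_num)
    have ibp := LipschitzWith.integral_lineDeriv_mul_eq (μ := volume) hKw hK2 hgc (e i)
    have h1 : ∀ x, lineDeriv ℝ (w i) x (e i) = fderiv ℝ (w i) x (e i) := fun x =>
      ((hw1 i).differentiable (by norm_num) x).lineDeriv_eq_fderiv
    simp only [h1] at ibp
    have h2 : ∀ᵐ x, lineDeriv ℝ (fun x => ψ x * (ψ x * v x)) x (-e i) * w i x =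
        -(2 * (ψ x * v x * w i x) * fderiv ℝ ψ x (e i)) - ψ x ^ 2 * w i x ^ 2 := by
      filter_upwards [hψ.ae_differentiableAt (μ := volume)] with x hx
      have hvx : DifferentiableAt ℝ v x := hv.differentiable (by norm_num) x
      have hd := (hx.hasFDerivAt.mul (hx.hasFDerivAt.mul hvx.hasFDerivAt))
      have := (hd.hasLineDerivAt (-e i)).lineDeriv
      rw [show (fun x => ψ x * (ψ x * v x)) = ψ * (ψ * v) from rfl, this]
      simp [hw]
      ring
    rw [ibp, integral_congr_ae h2]
    have iC : Integrable (fun x => 2 * (ψ x * v x * w i x) * fderiv ℝ ψ x (e i)) := by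
      have i1 : Integrable (fun x => 2 * (ψ x * v x * w i x)) :=
        Continuous.integrable_of_hasCompactSupport (by fun_prop)
          ((hwc i).mul_left.mul_left)
      refine i1.mul_bdd (c := K * ‖e i‖) ?_ (ae_of_all _ fun x => ?_)
      · exact (measurable_fderiv_apply_const ℝ ψ (e i)).aestronglyMeasurable
      · exact ((fderiv ℝ ψ x).le_opNorm _).trans
          (by gcongr; exact norm_fderiv_le_of_lipschitz ℝ hψ)
    have hle : -(∫ x, 2 * (ψ x * v x * w i x) * fderiv ℝ ψ x (e i)) ≤
        (1 / 2) * (∫ x, ψ x ^ 2 * w i x ^ 2) + 2 * ∫ x, fderiv ℝ ψ x (e i) ^ 2 := by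
      rw [← integral_neg, ← integral_const_mul, ← integral_const_mul,
        ← integral_add ((iA i).const_mul _) ((iB i).const_mul _)]
      refine integral_mono iC.neg (((iA i).const_mul _).add ((iB i).const_mul _)) fun x => ?_
      dsimp only
      by_cases hx : ψ x = 0
      · simp [hx]; positivity
      · obtain ⟨h0, h1⟩ := hb x hx
        have h3 : (ψ x * w i x) ^ 2 * v x ^ 2 ≤ (ψ x * w i x) ^ 2 :=
          mul_le_of_le_one_right (sq_nonneg _) (by nlinarith)
        nlinarith [sq_nonneg (ψ x * w i x * v x + 2 * fderiv ℝ ψ x (e i))]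
    have hsub := integral_sub iC.neg (iA i)
    simp only [Pi.neg_apply] at hsub
    rw [hsub, integral_neg]
    linarith
  have hsum : 0 ≤ ∑ i, ∫ x, fderiv ℝ (w i) x (e i) * (ψ x * (ψ x * v x)) := by
    rw [← integral_finsetSum _ fun i _ => iL i]
    refine integral_nonneg fun x => ?_
    dsimp only
    rw [← Finset.sum_mul]
    by_cases hx : ψ x = 0
    · simp [hx]
    · have : 0 ≤ ∑ i, fderiv ℝ (w i) x (e i) := hΔ x hx
      have h4 : ψ x * (ψ x * v x) = ψ x ^ 2 * v x := by ring
      rw [h4]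
      exact mul_nonneg this (mul_nonneg (sq_nonneg _) (hb x hx).1)
  have e1 : (fun x => ψ x ^ 2 * ‖fderiv ℝ v x‖ ^ 2) = fun x => ∑ i, ψ x ^ 2 * w i x ^ 2 := by
    ext x; rw [norm_sq_eq_sum_apply_single, Finset.mul_sum]
  have e2 : (fun x => ‖fderiv ℝ ψ x‖ ^ 2) = fun x => ∑ i, fderiv ℝ ψ x (e i) ^ 2 := by
    ext x; rw [norm_sq_eq_sum_apply_single]
  rw [e1, e2]
  refine ⟨integrable_finsetSum _ fun i _ => iA i, integrable_finsetSum _ fun i _ => iB i, ?_⟩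
  rw [integral_finsetSum _ fun i _ => iA i, integral_finsetSum _ fun i _ => iB i, Finset.mul_sum]
  have := Finset.sum_le_sum fun i (_ : i ∈ Finset.univ) => key i
  rw [Finset.sum_sub_distrib, ← Finset.mul_sum Finset.univ _ (2 : ℝ)] at this
  linarith

/-- The tubular neighbourhoods of `K` have volume `O(ε²)`, as for a bounded piece of a set of
codimension at least two. -/
def HasQuadraticTubes {n : ℕ} (K : Set (E n)) : Prop :=
  ∃ C : ℝ≥0∞, C ≠ ∞ ∧ ∀ ε : ℝ, 0 < ε → ε ≤ 1 →
    volume (thickening ε K) ≤ C * ENNReal.ofReal (ε ^ 2)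

/-- `K` has vanishing `H¹`-capacity, witnessed by Lipschitz cutoffs supported near `K`. -/
def HasZeroCapacity {n : ℕ} (K : Set (E n)) : Prop :=
  ∀ δ : ℝ, 0 < δ → ∀ ε : ℝ≥0∞, ε ≠ 0 → ∃ (χ : E n → ℝ) (L : ℝ≥0) (W : Set (E n)),
    LipschitzWith L χ ∧ (∀ x, 0 ≤ χ x ∧ χ x ≤ 1) ∧ IsOpen W ∧ K ⊆ W ∧ (∀ x ∈ W, χ x = 1) ∧
      (∀ x, x ∉ thickening δ K → χ x = 0) ∧ ∫⁻ x, ‖fderiv ℝ χ x‖ₑ ^ 2 ≤ ε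

lemma hasQuadraticTubes_image {d n : ℕ} (hdn : d + 2 ≤ n) {L : ℝ≥0} {F : E d → E n}
    (hF : LipschitzWith L F) {A : Set (E d)} (hA : Bornology.IsBounded A) :
    HasQuadraticTubes (F '' A) := by
  set v := volume (ball (0 : E d) 1) with hv
  have hv0 : v ≠ 0 := (measure_ball_pos _ _ one_pos).ne'
  have hvt : v ≠ ∞ := measure_ball_lt_top.ne
  set b := volume (ball (0 : E n) 1) with hb
  have hbt : b ≠ ∞ := measure_ball_lt_top.ne
  set T := volume (thickening 1 A) with hT
  have hTt : T ≠ ∞ := hA.thickening.measure_lt_top.ne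
  refine ⟨v⁻¹ * (ENNReal.ofReal ((1 + L) ^ n) * b * T), ?_, fun ε hε hε1 => ?_⟩
  · exact ENNReal.mul_ne_top (ENNReal.inv_ne_top.2 hv0)
      (ENNReal.mul_ne_top (ENNReal.mul_ne_top ENNReal.ofReal_ne_top hbt) hTt)
  set P : Set (E n × E d) := {p | dist p.1 (F p.2) < (1 + L) * ε} with hP
  have hPm : MeasurableSet P := by
    have := hF.continuous
    exact (isOpen_lt (by fun_prop) continuous_const).measurableSet
  have hpt : ∀ x ∈ thickening ε (F '' A), ENNReal.ofReal (ε ^ d) * v ≤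
      (volume.restrict (thickening 1 A)) {y | (x, y) ∈ P} := by
    intro x hx
    obtain ⟨_, ⟨a, ha, rfl⟩, hxa⟩ := mem_thickening_iff.1 hx
    have hball : volume (ball a ε) = ENNReal.ofReal (ε ^ d) * v := by
      rw [Measure.addHaar_ball_of_pos _ _ hε]; simp [hv]
    rw [← hball]
    have hsub : ball a ε ⊆ thickening 1 A := fun y hy =>
      mem_thickening_iff.2 ⟨a, ha, lt_of_lt_of_le hy hε1⟩
    rw [← Measure.restrict_eq_self volume hsub]
    refine measure_mono fun y hy => ?_
    have h1 := hF.dist_le_mul a y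
    have h2 : (L : ℝ) * dist a y ≤ L * ε := by
      rw [dist_comm]; gcongr; exact (mem_ball.1 hy).le
    have h3 := dist_triangle x (F a) (F y)
    simp only [hP, Set.mem_ofPred_eq]
    linarith
  have hslice : ∀ y, volume {x | (x, y) ∈ P} = ENNReal.ofReal ((1 + L) ^ n * ε ^ n) * b := by
    intro y
    have : {x | (x, y) ∈ P} = ball (F y) ((1 + L) * ε) := by ext; simp [hP]
    rw [this, Measure.addHaar_ball_of_pos _ _ (by positivity), mul_pow]; simp [hb]
  have hfub : ENNReal.ofReal (ε ^ d) * v * volume (thickening ε (F '' A)) ≤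
      ENNReal.ofReal ((1 + L) ^ n * ε ^ n) * b * T := by
    calc _ = ∫⁻ x in thickening ε (F '' A), ENNReal.ofReal (ε ^ d) * v := by
          rw [setLIntegral_const]
      _ ≤ ∫⁻ x in thickening ε (F '' A), (volume.restrict (thickening 1 A)) {y | (x, y) ∈ P} :=
          setLIntegral_mono' isOpen_thickening.measurableSet hpt
      _ ≤ ∫⁻ x, (volume.restrict (thickening 1 A)) {y | (x, y) ∈ P} :=
          setLIntegral_le_lintegral _ _
      _ = ((volume : Measure (E n)).prod (volume.restrict (thickening 1 A))) P :=
          (Measure.prod_apply hPm).symm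
      _ = ∫⁻ y in thickening 1 A, volume {x | (x, y) ∈ P} := Measure.prod_apply_symm hPm
      _ = _ := by simp only [hslice]; rw [setLIntegral_const]
  have hεd : ENNReal.ofReal (ε ^ d) ≠ 0 := by
    rw [Ne, ENNReal.ofReal_eq_zero, not_le]; positivity
  have hsplit : ENNReal.ofReal ((1 + L) ^ n * ε ^ n) ≤
      ENNReal.ofReal (ε ^ d) * (ENNReal.ofReal ((1 + L) ^ n) * ENNReal.ofReal (ε ^ 2)) := by
    rw [← ENNReal.ofReal_mul (by positivity), ← ENNReal.ofReal_mul (by positivity)]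
    apply ENNReal.ofReal_le_ofReal
    have : ε ^ n ≤ ε ^ (d + 2) := pow_le_pow_of_le_one hε.le hε1 hdn
    calc (1 + (L : ℝ)) ^ n * ε ^ n ≤ (1 + (L : ℝ)) ^ n * ε ^ (d + 2) := by gcongr
      _ = _ := by ring
  have hfin : ENNReal.ofReal (ε ^ d) * (v * volume (thickening ε (F '' A))) ≤
      ENNReal.ofReal (ε ^ d) * (ENNReal.ofReal ((1 + L) ^ n) * b * T * ENNReal.ofReal (ε ^ 2)) := by
    calc _ = ENNReal.ofReal (ε ^ d) * v * volume (thickening ε (F '' A)) := by ring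
      _ ≤ _ := hfub
      _ ≤ ENNReal.ofReal (ε ^ d) *
            (ENNReal.ofReal ((1 + L) ^ n) * ENNReal.ofReal (ε ^ 2)) * b * T := by gcongr
      _ = _ := by ring
  rw [ENNReal.mul_le_mul_iff_right hεd ENNReal.ofReal_ne_top] at hfin
  calc volume (thickening ε (F '' A)) = v⁻¹ * (v * volume (thickening ε (F '' A))) := by
        rw [← mul_assoc, ENNReal.inv_mul_cancel hv0 hvt, one_mul]
    _ ≤ v⁻¹ * (ENNReal.ofReal ((1 + L) ^ n) * b * T * ENNReal.ofReal (ε ^ 2)) := by gcongr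
    _ = _ := by ring

lemma enorm_zero_clm {n : ℕ} : ‖(0 : E n →L[ℝ] ℝ)‖ₑ = 0 := by
  rw [← ofReal_norm, norm_zero, ENNReal.ofReal_zero]

lemma enorm_sum_sq_le_of_subsingleton_support {ι V : Type*} [SeminormedAddCommGroup V]
    (s : Finset ι) (a : ι → V) (h : ∀ i ∈ s, ∀ j ∈ s, a i ≠ 0 → a j ≠ 0 → i = j) :
    ‖∑ i ∈ s, a i‖ₑ ^ 2 ≤ ∑ i ∈ s, ‖a i‖ₑ ^ 2 := by
  by_cases hex : ∃ i ∈ s, a i ≠ 0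
  · obtain ⟨i, hi, hai⟩ := hex
    rw [Finset.sum_eq_single_of_mem i hi fun j hj hji => by
      by_contra hj0; exact hji (h j hj i hi hj0 hai)]
    exact Finset.single_le_sum (f := fun i => ‖a i‖ₑ ^ 2) (fun _ _ => zero_le) hi
  · push Not at hex
    rw [Finset.sum_eq_zero hex, ← ofReal_norm, norm_zero]
    simp

lemma exists_lipschitzWith_sum {ι X : Type*} [PseudoMetricSpace X] (s : Finset ι) (f : ι → X → ℝ)
    (hf : ∀ i, ∃ L, LipschitzWith L (f i)) : ∃ L, LipschitzWith L (fun x => ∑ i ∈ s, f i x) := by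
  classical
  induction s using Finset.induction_on with
  | empty => exact ⟨0, by simp⟩
  | insert i s hi ih =>
    obtain ⟨L, hL⟩ := ih
    obtain ⟨M, hM⟩ := hf i
    exact ⟨M + L, by simpa [Finset.sum_insert hi] using hM.add hL⟩

/-- The Lipschitz cutoff equal to `1` where `s * dist(x, K) ≤ 1` and to `0` where
`2 ≤ s * dist(x, K)`. -/
def tubeCutoff {n : ℕ} (K : Set (E n)) (s : ℝ) (x : E n) : ℝ :=
  max 0 (min 1 (2 - s * infDist x K))

lemma lipschitzWith_tubeCutoff {n : ℕ} (K : Set (E n)) {s : ℝ} (hs : 0 ≤ s) :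
    LipschitzWith s.toNNReal (tubeCutoff K s) := by
  have h : LipschitzWith s.toNNReal (fun x : E n => 2 - s * infDist x K) :=
    LipschitzWith.of_dist_le' fun x y => by
      have := (lipschitz_infDist_pt K).dist_le_mul x y
      simp only [NNReal.coe_one, one_mul] at this
      rw [dist_sub_left, Real.dist_eq, ← mul_sub, abs_mul, abs_of_nonneg hs, ← Real.dist_eq]
      gcongr
  exact (h.const_min 1).const_max 0

lemma tubeCutoff_mem_Icc {n : ℕ} (K : Set (E n)) (s : ℝ) (x : E n) :
    0 ≤ tubeCutoff K s x ∧ tubeCutoff K s x ≤ 1 := by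
  simp [tubeCutoff]

lemma tubeCutoff_eq_one {n : ℕ} {K : Set (E n)} {s : ℝ} {x : E n} (h : s * infDist x K ≤ 1) :
    tubeCutoff K s x = 1 := by
  rw [tubeCutoff, min_eq_left (by linarith)]; simp

lemma tubeCutoff_eq_zero {n : ℕ} {K : Set (E n)} {s : ℝ} {x : E n} (h : 2 ≤ s * infDist x K) :
    tubeCutoff K s x = 0 := by
  rw [tubeCutoff, max_eq_left]
  exact (min_le_right _ _).trans (by linarith)

lemma mem_of_fderiv_tubeCutoff_ne_zero {n : ℕ} {K : Set (E n)} {s : ℝ} {x : E n}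
    (h : fderiv ℝ (tubeCutoff K s) x ≠ 0) : 1 ≤ s * infDist x K ∧ s * infDist x K ≤ 2 := by
  have hc : Continuous fun y : E n => s * infDist y K := continuous_const.mul (continuous_infDist_pt K)
  constructor
  · by_contra! hlt
    have : tubeCutoff K s =ᶠ[nhds x] fun _ => 1 := by
      filter_upwards [hc.continuousAt.eventually_lt_const hlt] with y hy
      exact tubeCutoff_eq_one hy.le
    exact h (by rw [this.fderiv_eq]; simp)
  · by_contra! hlt
    have : tubeCutoff K s =ᶠ[nhds x] fun _ => 0 := by
      filter_upwards [hc.continuousAt.eventually_const_lt hlt] with y hy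
      exact tubeCutoff_eq_zero hy.le
    exact h (by rw [this.fderiv_eq]; simp)

lemma lintegral_enorm_fderiv_tubeCutoff_sq_le {n : ℕ} {K : Set (E n)} (hK : K.Nonempty)
    {C : ℝ≥0∞} (hC : ∀ ε : ℝ, 0 < ε → ε ≤ 1 →
      volume (thickening ε K) ≤ C * ENNReal.ofReal (ε ^ 2)) {s : ℝ} (hs : 3 ≤ s) :
    ∫⁻ x, ‖fderiv ℝ (tubeCutoff K s) x‖ₑ ^ 2 ≤ 9 * C := by
  have hs0 : 0 < s := by linarith
  calc ∫⁻ x, ‖fderiv ℝ (tubeCutoff K s) x‖ₑ ^ 2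
      ≤ ∫⁻ x, (thickening (3 / s) K).indicator (fun _ => ENNReal.ofReal (s ^ 2)) x := by
        refine lintegral_mono fun x => ?_
        by_cases hx : fderiv ℝ (tubeCutoff K s) x = 0
        · simp [hx, enorm_zero_clm]
        · have h2 := (mem_of_fderiv_tubeCutoff_ne_zero hx).2
          rw [Set.indicator_of_mem, ENNReal.ofReal_pow hs0.le, ← ofReal_norm]
          · gcongr
            simpa [hs0.le] using norm_fderiv_le_of_lipschitz ℝ (lipschitzWith_tubeCutoff K hs0.le)
          · rw [mem_thickening_iff_infDist_lt hK, lt_div_iff₀ hs0]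
            linarith
    _ = ENNReal.ofReal (s ^ 2) * volume (thickening (3 / s) K) := by
        rw [lintegral_indicator isOpen_thickening.measurableSet, setLIntegral_const]
    _ ≤ ENNReal.ofReal (s ^ 2) * (C * ENNReal.ofReal ((3 / s) ^ 2)) := by
        gcongr
        exact hC _ (by positivity) (by rw [div_le_one hs0]; exact hs)
    _ = 9 * C := by
        rw [mul_left_comm, ← ENNReal.ofReal_mul (by positivity), mul_comm]
        congr 1
        rw [show s ^ 2 * (3 / s) ^ 2 = 9 by field_simp; norm_num]
        norm_num

lemma HasQuadraticTubes.hasZeroCapacity {n : ℕ} {K : Set (E n)} (hK : HasQuadraticTubes K) :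
    HasZeroCapacity K := by
  intro δ hδ ε hε
  rcases K.eq_empty_or_nonempty with rfl | hne
  · exact ⟨fun _ => 0, 0, ∅, LipschitzWith.const 0, by simp, isOpen_empty, subset_rfl, by simp,
      by simp, by simp [enorm_zero_clm]⟩
  obtain ⟨C, hCt, hC⟩ := hK
  obtain ⟨N, hN⟩ := ENNReal.exists_nat_gt
    (ENNReal.div_ne_top (ENNReal.mul_ne_top (by norm_num : (9 : ℝ≥0∞) ≠ ∞) hCt) hε)
  have hN0 : (N : ℝ≥0∞) ≠ 0 := (zero_le.trans_lt hN).ne'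
  have hNr : (0 : ℝ) < N := by exact_mod_cast Nat.pos_of_ne_zero (by exact_mod_cast hN0)
  obtain ⟨M, hM⟩ := pow_unbounded_of_one_lt (2 / δ) (by norm_num : (1 : ℝ) < 4)
  set s : ℕ → ℝ := fun k => 4 ^ (M + 1 + k) with hs
  have hs0 : ∀ k, 0 < s k := fun k => by positivity
  have hs3 : ∀ k, 3 ≤ s k := fun k => by
    have : (4 : ℝ) ^ 1 ≤ s k := pow_le_pow_right₀ (by norm_num) (by lia)
    linarith
  have hsδ : ∀ k, 2 ≤ s k * δ := fun k => by
    rw [div_lt_iff₀ hδ] at hM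
    have : (4 : ℝ) ^ M ≤ s k := pow_le_pow_right₀ (by norm_num) (by lia)
    nlinarith
  have hsmono : Monotone s := fun i j hij => pow_le_pow_right₀ (by norm_num) (by lia)
  set φ : ℕ → E n → ℝ := fun k => tubeCutoff K (s k) with hφ
  have hφL : ∀ k, LipschitzWith (s k).toNNReal (φ k) := fun k =>
    lipschitzWith_tubeCutoff K (hs0 k).le
  obtain ⟨L, hL⟩ := exists_lipschitzWith_sum (Finset.range N) φ fun k => ⟨_, hφL k⟩
  set F : E n → ℝ := fun x => ∑ k ∈ Finset.range N, φ k x with hF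
  have hF0 : ∀ x, 0 ≤ F x := fun x => Finset.sum_nonneg fun k _ => (tubeCutoff_mem_Icc K _ x).1
  have hFN : ∀ x, F x ≤ N := fun x => by
    simpa using Finset.sum_le_card_nsmul (Finset.range N) (fun k => φ k x) 1
      fun k _ => (tubeCutoff_mem_Icc K _ x).2
  refine ⟨fun x => (N : ℝ)⁻¹ * F x, Real.toNNReal ((N : ℝ)⁻¹ * L),
    {x | s N * infDist x K < 1}, ?_, fun x => ⟨by have := hF0 x; positivity, ?_⟩, ?_, ?_, ?_, ?_, ?_⟩
  · refine LipschitzWith.of_dist_le' fun x y => ?_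
    rw [Real.dist_eq, ← mul_sub, abs_mul, abs_of_pos (by positivity), mul_assoc, ← Real.dist_eq]
    gcongr
    exact hL.dist_le_mul x y
  · rw [inv_mul_le_iff₀ hNr]; simpa using hFN x
  · exact isOpen_lt (continuous_const.mul (continuous_infDist_pt K)) continuous_const
  · intro x hx
    simp [infDist_zero_of_mem hx]
  · intro x hx
    have : F x = N := by
      rw [hF]
      dsimp only
      rw [Finset.sum_congr rfl fun k hk => tubeCutoff_eq_one (s := s k) (K := K) (x := x) ?_]
      · simp
      · have := hsmono (Finset.mem_range.1 hk).le
        have h0 : 0 ≤ infDist x K := infDist_nonneg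
        have hx' : s N * infDist x K < 1 := hx
        nlinarith
    simp [this, hNr.ne']
  · intro x hx
    rw [mem_thickening_iff_infDist_lt hne, not_lt] at hx
    have : F x = 0 := Finset.sum_eq_zero fun k _ => tubeCutoff_eq_zero <|
      (hsδ k).trans (by have := hs0 k; gcongr)
    simp [this]
  · have hae : ∀ᵐ x, ‖fderiv ℝ (fun x => (N : ℝ)⁻¹ * F x) x‖ₑ ^ 2 ≤
        ((N : ℝ≥0∞)⁻¹) ^ 2 * ∑ k ∈ Finset.range N, ‖fderiv ℝ (φ k) x‖ₑ ^ 2 := by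
      filter_upwards [ae_all_iff.2 fun k => (hφL k).ae_differentiableAt (μ := volume)] with x hx
      have hd : DifferentiableAt ℝ F x := DifferentiableAt.fun_sum fun k _ => hx k
      rw [fderiv_const_mul hd, enorm_smul, mul_pow]
      have hn : ‖(N : ℝ)⁻¹‖ₑ = (N : ℝ≥0∞)⁻¹ := by
        rw [Real.enorm_eq_ofReal (by positivity), ENNReal.ofReal_inv_of_pos hNr]; simp
      rw [hn, hF, fderiv_fun_sum fun k _ => hx k]
      gcongr
      refine enorm_sum_sq_le_of_subsingleton_support _ _ fun i _ j _ hi hj => ?_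
      obtain ⟨hi1, hi2⟩ := mem_of_fderiv_tubeCutoff_ne_zero hi
      obtain ⟨hj1, hj2⟩ := mem_of_fderiv_tubeCutoff_ne_zero hj
      have hstep : ∀ a b : ℕ, a < b → 4 * s a ≤ s b := fun a b hab => by
        calc 4 * s a = s (a + 1) := by simp only [hs]; ring
          _ ≤ s b := hsmono hab
      have h0 : 0 ≤ infDist x K := infDist_nonneg
      by_contra hij
      rcases lt_or_gt_of_ne hij with h | h <;> nlinarith [hstep _ _ h]
    have hmeas : ∀ k, Measurable fun x => ‖fderiv ℝ (φ k) x‖ₑ ^ 2 := fun k =>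
      (measurable_fderiv ℝ (φ k)).enorm.pow_const 2
    calc _ ≤ ∫⁻ x, ((N : ℝ≥0∞)⁻¹) ^ 2 * ∑ k ∈ Finset.range N, ‖fderiv ℝ (φ k) x‖ₑ ^ 2 :=
          lintegral_mono_ae hae
      _ = ((N : ℝ≥0∞)⁻¹) ^ 2 * ∑ k ∈ Finset.range N, ∫⁻ x, ‖fderiv ℝ (φ k) x‖ₑ ^ 2 := by
          rw [lintegral_const_mul _ (Finset.measurable_fun_sum _ fun k _ => hmeas k),
            lintegral_finsetSum _ fun k _ => hmeas k]
      _ ≤ ((N : ℝ≥0∞)⁻¹) ^ 2 * ∑ k ∈ Finset.range N, 9 * C := by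
          gcongr with k _
          exact lintegral_enorm_fderiv_tubeCutoff_sq_le hne hC (hs3 k)
      _ = (N : ℝ≥0∞)⁻¹ * (9 * C) := by
          rw [Finset.sum_const, Finset.card_range, nsmul_eq_mul, sq, mul_assoc,
            ← mul_assoc _ (N : ℝ≥0∞), ENNReal.inv_mul_cancel hN0 (by simp), one_mul]
      _ ≤ ε := by
          rw [ENNReal.inv_mul_le_iff hN0 (by simp)]
          by_cases hεt : ε = ∞
          · simp [hεt, hN0]
          · exact (ENNReal.div_le_iff hε hεt).1 hN.le

lemma exists_finset_max_cutoff {n : ℕ} {ι : Type*} (t : Finset ι) (χ : ι → E n → ℝ)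
    (hL : ∀ i, ∃ L, LipschitzWith L (χ i)) (hχ : ∀ i x, 0 ≤ χ i x ∧ χ i x ≤ 1) :
    ∃ (X : E n → ℝ) (L : ℝ≥0), LipschitzWith L X ∧ (∀ x, 0 ≤ X x ∧ X x ≤ 1) ∧
      (∀ i ∈ t, ∀ x, χ i x ≤ X x) ∧ (∀ x, (∀ i, χ i x = 0) → X x = 0) ∧
      ∫⁻ x, ‖fderiv ℝ X x‖ₑ ^ 2 ≤ ∑ i ∈ t, ∫⁻ x, ‖fderiv ℝ (χ i) x‖ₑ ^ 2 := by
  classical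
  induction t using Finset.induction_on with
  | empty => exact ⟨fun _ => 0, 0, LipschitzWith.const 0, by simp, by simp, by simp,
      by simp [enorm_zero_clm]⟩
  | insert i s hi ih =>
    obtain ⟨X, L, hX, hX01, hle, hzero, hint⟩ := ih
    obtain ⟨M, hM⟩ := hL i
    have hmax : LipschitzWith (max M L) (fun x => max (χ i x) (X x)) := hM.max hX
    refine ⟨fun x => max (χ i x) (X x), _, hmax, fun x => ⟨(hχ i x).1.trans (le_max_left _ _),
      max_le (hχ i x).2 (hX01 x).2⟩, ?_, fun x hx => by simp [hx i, hzero x hx], ?_⟩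
    · intro j hj x
      rcases Finset.mem_insert.1 hj with rfl | hj
      · exact le_max_left _ _
      · exact (hle j hj x).trans (le_max_right _ _)
    · have hae : ∀ᵐ x, ‖fderiv ℝ (fun x => max (χ i x) (X x)) x‖ₑ ^ 2 ≤
          ‖fderiv ℝ (χ i) x‖ₑ ^ 2 + ‖fderiv ℝ X x‖ₑ ^ 2 := by
        filter_upwards [hmax.ae_differentiableAt (μ := volume),
          hM.ae_differentiableAt (μ := volume), hX.ae_differentiableAt (μ := volume)]
          with x h1 h2 h3
        have aux : ∀ g : E n → ℝ, DifferentiableAt ℝ g x → (∀ y, g y ≤ max (χ i y) (X y)) →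
            g x = max (χ i x) (X x) →
            fderiv ℝ (fun x => max (χ i x) (X x)) x = fderiv ℝ g x := by
          intro g hg hgle hgx
          have hmin : IsLocalMin (fun y => max (χ i y) (X y) - g y) x :=
            Filter.Eventually.of_forall fun y => by
              have := hgle y
              simp only [← hgx]
              linarith
          have := hmin.fderiv_eq_zero
          rwa [fderiv_fun_sub h1 hg, sub_eq_zero] at this
        rcases le_total (χ i x) (X x) with h | h
        · rw [aux X h3 (fun y => le_max_right _ _) (max_eq_right h).symm]
          exact le_add_self
        · rw [aux (χ i) h2 (fun y => le_max_left _ _) (max_eq_left h).symm]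
          exact le_self_add
      calc _ ≤ ∫⁻ x, ‖fderiv ℝ (χ i) x‖ₑ ^ 2 + ‖fderiv ℝ X x‖ₑ ^ 2 := lintegral_mono_ae hae
        _ = (∫⁻ x, ‖fderiv ℝ (χ i) x‖ₑ ^ 2) + ∫⁻ x, ‖fderiv ℝ X x‖ₑ ^ 2 :=
            lintegral_add_left ((measurable_fderiv ℝ (χ i)).enorm.pow_const 2) _
        _ ≤ _ := by rw [Finset.sum_insert hi]; gcongr

lemma exists_cutoff_of_countable_cover {n : ℕ} {ι : Type*} [Countable ι] {K : ι → Set (E n)}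
    (hK : ∀ i, HasZeroCapacity (K i)) {T : Set (E n)} (hT : IsCompact T) (hTK : T ⊆ ⋃ i, K i)
    {δ : ℝ} (hδ : 0 < δ) {ε : ℝ≥0∞} (hε : ε ≠ 0) :
    ∃ (χ : E n → ℝ) (L : ℝ≥0) (W : Set (E n)),
      LipschitzWith L χ ∧ (∀ x, 0 ≤ χ x ∧ χ x ≤ 1) ∧ IsOpen W ∧ T ⊆ W ∧ (∀ x ∈ W, χ x = 1) ∧
      (∀ x, x ∉ thickening δ (⋃ i, K i) → χ x = 0) ∧ ∫⁻ x, ‖fderiv ℝ χ x‖ₑ ^ 2 ≤ ε := by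
  obtain ⟨ε', hε'0, hε'⟩ := ENNReal.exists_pos_sum_of_countable hε ι
  choose χ L W hL h01 hWo hKW hW1 hsupp hint using
    fun i => hK i δ hδ (ε' i) (by exact_mod_cast (hε'0 i).ne')
  obtain ⟨t, ht⟩ := hT.elim_finite_subcover W hWo
    (hTK.trans (Set.iUnion_mono hKW))
  obtain ⟨X, M, hX, hX01, hle, hzero, hXint⟩ :=
    exists_finset_max_cutoff t χ (fun i => ⟨_, hL i⟩) h01
  refine ⟨X, M, ⋃ i ∈ t, W i, hX, hX01, isOpen_biUnion fun i _ => hWo i, ht, ?_, ?_, ?_⟩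
  · intro x hx
    obtain ⟨i, hi, hxi⟩ := Set.mem_iUnion₂.1 hx
    refine le_antisymm (hX01 x).2 ?_
    rw [← hW1 i x hxi]
    exact hle i hi x
  · intro x hx
    exact hzero x fun i => hsupp i x fun h =>
      hx (thickening_subset_of_subset δ (Set.subset_iUnion K i) h)
  · calc _ ≤ ∑ i ∈ t, ∫⁻ x, ‖fderiv ℝ (χ i) x‖ₑ ^ 2 := hXint
      _ ≤ ∑ i ∈ t, (ε' i : ℝ≥0∞) := Finset.sum_le_sum fun i _ => hint i
      _ ≤ ∑' i, (ε' i : ℝ≥0∞) := ENNReal.sum_le_tsum t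
      _ ≤ ε := hε'.le

lemma HasQuadraticTubes.volume_eq_zero {n : ℕ} {K : Set (E n)} (hK : HasQuadraticTubes K) :
    volume K = 0 := by
  obtain ⟨C, hCt, hC⟩ := hK
  have hlim : Filter.Tendsto (fun k : ℕ => C * ENNReal.ofReal ((1 / ((k : ℝ) + 1)) ^ 2))
      Filter.atTop (nhds 0) := by
    have h1 := (tendsto_one_div_add_atTop_nhds_zero_nat (𝕜 := ℝ)).pow 2
    have h2 := ENNReal.Tendsto.const_mul (a := C) (ENNReal.tendsto_ofReal h1) (Or.inr hCt)
    simpa using h2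
  refine le_antisymm (ge_of_tendsto' hlim fun k => ?_) zero_le
  refine (measure_mono (self_subset_thickening (by positivity) K)).trans
    (hC (1 / ((k : ℝ) + 1)) (by positivity) ?_)
  rw [div_le_one (by positivity)]
  linarith [k.cast_nonneg (α := ℝ)]

lemma exists_countable_quadraticTubes_image {d n : ℕ} (hdn : d + 2 ≤ n) {V A : Set (E d)}
    (hV : IsOpen V) {f : E d → E n} (hf : ContDiffOn ℝ (⊤ : ℕ∞) f V) (hA : A ⊆ V) :
    ∃ 𝒦 : Set (Set (E n)), 𝒦.Countable ∧ (∀ K ∈ 𝒦, HasQuadraticTubes K) ∧ ⋃₀ 𝒦 = f '' A := by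
  have hloc : ∀ y, ∃ t : Set (E d), y ∈ A →
      t ∈ nhds y ∧ Bornology.IsBounded t ∧ ∃ L, LipschitzOnWith L f t := by
    intro y
    by_cases hy : y ∈ A
    · have hfy : ContDiffAt ℝ 1 f y :=
        (hf.contDiffAt (hV.mem_nhds (hA hy))).of_le (by exact_mod_cast le_top)
      obtain ⟨L, t, ht, hL⟩ := hfy.exists_lipschitzOnWith
      exact ⟨t ∩ ball y 1, fun _ => ⟨Filter.inter_mem ht (ball_mem_nhds y one_pos),
        isBounded_ball.subset Set.inter_subset_right, L, hL.mono Set.inter_subset_left⟩⟩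
    · exact ⟨∅, fun h => absurd h hy⟩
  choose t ht using hloc
  obtain ⟨s, hsA, hs, hcov⟩ := TopologicalSpace.countable_cover_nhdsWithin (f := t) (s := A)
    fun y hy => mem_nhdsWithin_of_mem_nhds (ht y hy).1
  refine ⟨(fun y => f '' (A ∩ t y)) '' s, hs.image _, ?_, ?_⟩
  · rintro _ ⟨y, hy, rfl⟩
    obtain ⟨-, hb, L, hL⟩ := ht y (hsA hy)
    obtain ⟨F, hF, hFf⟩ := hL.extend_finite_dimension
    have : f '' (A ∩ t y) = F '' (A ∩ t y) :=
      (hFf.mono Set.inter_subset_right).image_eq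
    dsimp only
    rw [this]
    exact hasQuadraticTubes_image hdn hF (hb.subset Set.inter_subset_right)
  · rw [Set.sUnion_image, ← Set.image_iUnion₂, ← Set.inter_iUnion₂,
      Set.inter_eq_left.2 hcov]

lemma IsClosedSubmanifoldCodimGe2.exists_countable_quadraticTubes {n : ℕ} {S : Set (E n)}
    (hS : IsClosedSubmanifoldCodimGe2 S) :
    ∃ 𝒦 : Set (Set (E n)), 𝒦.Countable ∧ (∀ K ∈ 𝒦, HasQuadraticTubes K) ∧ ⋃₀ 𝒦 = S := by
  obtain ⟨-, d, hdn, hloc⟩ := hS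
  have hloc' : ∀ x, ∃ (U : Set (E n)) (𝒦 : Set (Set (E n))), x ∈ S → U ∈ nhds x ∧
      𝒦.Countable ∧ (∀ K ∈ 𝒦, HasQuadraticTubes K) ∧ ⋃₀ 𝒦 = S ∩ U := by
    intro x
    by_cases hx : x ∈ S
    · obtain ⟨V, f, U, hV, hU, hxU, hf, -, h | ⟨i, h⟩⟩ := hloc x hx
      · obtain ⟨𝒦, h1, h2, h3⟩ := exists_countable_quadraticTubes_image hdn hV hf subset_rfl
        exact ⟨U, 𝒦, fun _ => ⟨hU.mem_nhds hxU, h1, h2, h3.trans h⟩⟩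
      · obtain ⟨𝒦, h1, h2, h3⟩ := exists_countable_quadraticTubes_image hdn hV hf
          (A := {y ∈ V | 0 ≤ y i}) (fun y hy => hy.1)
        exact ⟨U, 𝒦, fun _ => ⟨hU.mem_nhds hxU, h1, h2, h3.trans h⟩⟩
    · exact ⟨∅, ∅, fun h => absurd h hx⟩
  choose U 𝒦 h using hloc'
  obtain ⟨s, hsS, hs, hcov⟩ := TopologicalSpace.countable_cover_nhdsWithin (f := U) (s := S)
    fun x hx => mem_nhdsWithin_of_mem_nhds (h x hx).1
  refine ⟨⋃ x ∈ s, 𝒦 x, hs.biUnion fun x hx => (h x (hsS hx)).2.1, ?_, ?_⟩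
  · intro K hK
    obtain ⟨x, hx, hKx⟩ := Set.mem_iUnion₂.1 hK
    exact (h x (hsS hx)).2.2.1 K hKx
  · simp only [Set.sUnion_iUnion]
    rw [Set.iUnion₂_congr fun x hx => (h x (hsS hx)).2.2.2, ← Set.inter_iUnion₂,
      Set.inter_eq_left.2 hcov]

open scoped Manifold ContDiff in
lemma exists_contDiff_hasCompactSupport_eqOn_nhdsSet {n : ℕ} {T Ω : Set (E n)} (hT : IsCompact T)
    (hΩ : IsOpen Ω) (hTΩ : T ⊆ Ω) {u : E n → ℝ} (hu : ContDiffOn ℝ (⊤ : ℕ∞) u Ω) :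
    ∃ v : E n → ℝ, ContDiff ℝ (⊤ : ℕ∞) v ∧ HasCompactSupport v ∧
      ∀ x ∈ T, v =ᶠ[nhds x] u := by
  obtain ⟨K, hK, hTK, hKΩ⟩ := exists_compact_between hT hΩ hTΩ
  obtain ⟨ζ, hζ1, hζ0, -⟩ := exists_contMDiffMap_one_nhds_of_subset_interior (n := (⊤ : ℕ∞))
    𝓘(ℝ, E n) hT.isClosed hTK
  have hsupp : tsupport (fun x => ζ x * u x) ⊆ K := by
    refine closure_minimal (fun x hx => ?_) hK.isClosed
    by_contra hxK
    exact hx (by simp [hζ0 x hxK])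
  refine ⟨fun x => ζ x * u x, (contMDiff_of_tsupport (I := 𝓘(ℝ, E n)) (I' := 𝓘(ℝ, ℝ))
    fun x hx => ContDiffAt.contMDiffAt ?_).contDiff,
    hK.of_isClosed_subset (isClosed_tsupport _) hsupp, fun x hx => ?_⟩
  · exact ζ.contMDiff.contDiff.contDiffAt.mul
      (hu.contDiffAt (hΩ.mem_nhds (hKΩ (hsupp hx))))
  · filter_upwards [eventually_nhdsSet_iff_forall.1 hζ1 x hx] with y hy
    simp [hy]

lemma elaplacian_congr {n : ℕ} {f g : E n → ℝ} {x : E n} (h : f =ᶠ[nhds x] g) :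
    elaplacian f x = elaplacian g x := by
  refine Finset.sum_congr rfl fun i _ => ?_
  have : (fun y => fderiv ℝ f y (EuclideanSpace.single i (1 : ℝ))) =ᶠ[nhds x]
      fun y => fderiv ℝ g y (EuclideanSpace.single i (1 : ℝ)) := by
    filter_upwards [h.fderiv (𝕜 := ℝ)] with y hy
    rw [hy]
  rw [this.fderiv_eq]

/-- Caccioppoli's inequality for a subharmonic function with values in `[0, 1]`. -/
lemma setLIntegral_enorm_fderiv_sq_le {n : ℕ} {Ω : Set (E n)} (hΩ : IsOpen Ω) {u : E n → ℝ}
    (hu : ContDiffOn ℝ (⊤ : ℕ∞) u Ω) (hΔ : ∀ x ∈ Ω, 0 ≤ elaplacian u x)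
    (hb : ∀ x ∈ Ω, 0 ≤ u x ∧ u x ≤ 1) {ψ : E n → ℝ} {L : ℝ≥0} (hψ : LipschitzWith L ψ)
    (hψc : HasCompactSupport ψ) (hψΩ : tsupport ψ ⊆ Ω) {A : Set (E n)} (hA : MeasurableSet A)
    (hψA : ∀ x ∈ A, ψ x = 1) :
    ∫⁻ x in A, ‖fderiv ℝ u x‖ₑ ^ 2 ≤ 4 * ∫⁻ x, ‖fderiv ℝ ψ x‖ₑ ^ 2 := by
  obtain ⟨v, hv, hvc, hvu⟩ := exists_contDiff_hasCompactSupport_eqOn_nhdsSet hψc hΩ hψΩ hu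
  have hmem : ∀ x, ψ x ≠ 0 → x ∈ tsupport ψ := fun x hx => subset_tsupport ψ hx
  obtain ⟨hi1, hi2, hle⟩ := integral_sq_mul_norm_fderiv_sq_le
    (by exact_mod_cast contDiff_infty.1 hv 2) hvc hψ hψc
    (fun x hx => by
      rw [elaplacian_congr (hvu x (hmem x hx))]; exact hΔ x (hψΩ (hmem x hx)))
    (fun x hx => by
      rw [(hvu x (hmem x hx)).eq_of_nhds]; exact hb x (hψΩ (hmem x hx)))
  calc ∫⁻ x in A, ‖fderiv ℝ u x‖ₑ ^ 2
      = ∫⁻ x in A, ENNReal.ofReal (ψ x ^ 2 * ‖fderiv ℝ v x‖ ^ 2) := by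
        refine setLIntegral_congr_fun hA fun x hx => ?_
        have hx1 := hψA x hx
        rw [(hvu x (hmem x (by simp [hx1]))).fderiv_eq, hx1, one_pow, one_mul,
          ENNReal.ofReal_pow (norm_nonneg _), ofReal_norm]
    _ ≤ ∫⁻ x, ENNReal.ofReal (ψ x ^ 2 * ‖fderiv ℝ v x‖ ^ 2) := setLIntegral_le_lintegral _ _
    _ = ENNReal.ofReal (∫ x, ψ x ^ 2 * ‖fderiv ℝ v x‖ ^ 2) :=
        (ofReal_integral_eq_lintegral_ofReal hi1 (ae_of_all _ fun x => by positivity)).symm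
    _ ≤ ENNReal.ofReal (4 * ∫ x, ‖fderiv ℝ ψ x‖ ^ 2) := ENNReal.ofReal_le_ofReal hle
    _ = 4 * ∫⁻ x, ‖fderiv ℝ ψ x‖ₑ ^ 2 := by
        rw [ENNReal.ofReal_mul (by norm_num),
          ofReal_integral_eq_lintegral_ofReal hi2 (ae_of_all _ fun x => by positivity)]
        simp_rw [ENNReal.ofReal_pow (norm_nonneg _), ofReal_norm]
        norm_num

/-- The Lipschitz cutoff equal to `1` on the ball of radius `r` and to `0` outside the ball of
radius `ρ`. -/
def radialCutoff {n : ℕ} (r ρ : ℝ) (x : E n) : ℝ :=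
  max 0 (min 1 ((ρ - r)⁻¹ * (ρ - ‖x‖)))

lemma lipschitzWith_radialCutoff {n : ℕ} {r ρ : ℝ} (h : r < ρ) :
    LipschitzWith (ρ - r)⁻¹.toNNReal (radialCutoff r ρ : E n → ℝ) := by
  have hpos : 0 < (ρ - r)⁻¹ := inv_pos.2 (sub_pos.2 h)
  have : LipschitzWith (ρ - r)⁻¹.toNNReal (fun x : E n => (ρ - r)⁻¹ * (ρ - ‖x‖)) :=
    LipschitzWith.of_dist_le' fun x y => by
      rw [Real.dist_eq, ← mul_sub, abs_mul, abs_of_pos hpos, sub_sub_sub_cancel_left, abs_sub_comm,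
        dist_eq_norm]
      gcongr
      exact abs_norm_sub_norm_le x y
  exact (this.const_min 1).const_max 0

lemma radialCutoff_mem_Icc {n : ℕ} (r ρ : ℝ) (x : E n) :
    0 ≤ radialCutoff r ρ x ∧ radialCutoff r ρ x ≤ 1 := by
  simp [radialCutoff]

lemma radialCutoff_eq_one {n : ℕ} {r ρ : ℝ} (h : r < ρ) {x : E n} (hx : ‖x‖ ≤ r) :
    radialCutoff r ρ x = 1 := by
  have : 1 ≤ (ρ - r)⁻¹ * (ρ - ‖x‖) := by
    rw [le_inv_mul_iff₀ (sub_pos.2 h)]; linarith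
  rw [radialCutoff, min_eq_left this]; simp

lemma radialCutoff_eq_zero {n : ℕ} {r ρ : ℝ} (h : r < ρ) {x : E n} (hx : ρ ≤ ‖x‖) :
    radialCutoff r ρ x = 0 := by
  have hpos : 0 < (ρ - r)⁻¹ := inv_pos.2 (sub_pos.2 h)
  rw [radialCutoff, max_eq_left]
  exact (min_le_right _ _).trans (mul_nonpos_of_nonneg_of_nonpos hpos.le (by linarith))

lemma tsupport_radialCutoff_subset {n : ℕ} {r ρ : ℝ} (h : r < ρ) :
    tsupport (radialCutoff r ρ : E n → ℝ) ⊆ closedBall 0 ρ := by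
  refine closure_minimal (fun x hx => ?_) isClosed_closedBall
  by_contra hxρ
  rw [mem_closedBall_zero_iff, not_le] at hxρ
  exact hx (radialCutoff_eq_zero h hxρ.le)

lemma lintegral_enorm_fderiv_radialCutoff_sq_le {n : ℕ} {r ρ : ℝ} (h : r < ρ) :
    ∫⁻ x, ‖fderiv ℝ (radialCutoff r ρ : E n → ℝ) x‖ₑ ^ 2 ≤
      ENNReal.ofReal ((ρ - r)⁻¹ ^ 2) * volume (closedBall (0 : E n) ρ) := by
  have hpos : 0 < (ρ - r)⁻¹ := inv_pos.2 (sub_pos.2 h)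
  rw [← setLIntegral_const, ← lintegral_indicator isClosed_closedBall.measurableSet]
  refine lintegral_mono fun x => ?_
  by_cases hx : fderiv ℝ (radialCutoff r ρ) x = 0
  · simp [hx, enorm_zero_clm]
  · rw [Set.indicator_of_mem (tsupport_radialCutoff_subset h (support_fderiv_subset ℝ hx)),
      ENNReal.ofReal_pow hpos.le, ← ofReal_norm]
    gcongr
    simpa only [Real.coe_toNNReal _ hpos.le] using
      norm_fderiv_le_of_lipschitz ℝ (x₀ := x) (lipschitzWith_radialCutoff h)

lemma lintegral_enorm_fderiv_mul_one_sub_sq_le {n : ℕ} {η χ : E n → ℝ} {L M : ℝ≥0}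
    (hη : LipschitzWith L η) (hχ : LipschitzWith M χ) (hη01 : ∀ x, 0 ≤ η x ∧ η x ≤ 1)
    (hχ01 : ∀ x, 0 ≤ χ x ∧ χ x ≤ 1) :
    ∫⁻ x, ‖fderiv ℝ (fun x => η x * (1 - χ x)) x‖ₑ ^ 2 ≤
      2 * (∫⁻ x, ‖fderiv ℝ η x‖ₑ ^ 2) + 2 * ∫⁻ x, ‖fderiv ℝ χ x‖ₑ ^ 2 := by
  have hm : ∀ f : E n → ℝ, Measurable fun x => ‖fderiv ℝ f x‖ₑ ^ 2 := fun f =>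
    (measurable_fderiv ℝ f).enorm.pow_const 2
  rw [← lintegral_const_mul _ (hm η), ← lintegral_const_mul _ (hm χ),
    ← lintegral_add_left ((hm η).const_mul 2)]
  refine lintegral_mono_ae ?_
  filter_upwards [hη.ae_differentiableAt (μ := volume), hχ.ae_differentiableAt (μ := volume)]
    with x h1 h2
  have hreal : ‖fderiv ℝ (fun x => η x * (1 - χ x)) x‖ ^ 2 ≤
      2 * ‖fderiv ℝ η x‖ ^ 2 + 2 * ‖fderiv ℝ χ x‖ ^ 2 := by
    rw [fderiv_fun_mul h1 (h2.const_sub 1), fderiv_const_sub]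
    obtain ⟨ha, hb⟩ := hη01 x
    obtain ⟨hc, hd⟩ := hχ01 x
    have hn : ‖η x • -fderiv ℝ χ x + (1 - χ x) • fderiv ℝ η x‖ ≤
        ‖fderiv ℝ χ x‖ + ‖fderiv ℝ η x‖ := by
      refine (norm_add_le _ _).trans ?_
      rw [norm_smul, norm_smul, norm_neg, Real.norm_of_nonneg ha,
        Real.norm_of_nonneg (sub_nonneg.2 hd)]
      gcongr
      · exact mul_le_of_le_one_left (norm_nonneg _) hb
      · exact mul_le_of_le_one_left (norm_nonneg _) (by linarith)
    nlinarith [pow_le_pow_left₀ (norm_nonneg _) hn 2,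
      sq_nonneg (‖fderiv ℝ χ x‖ - ‖fderiv ℝ η x‖)]
  have := ENNReal.ofReal_le_ofReal hreal
  rw [ENNReal.ofReal_add (by positivity) (by positivity), ENNReal.ofReal_mul (by norm_num),
    ENNReal.ofReal_mul (by norm_num)] at this
  simpa [ENNReal.ofReal_pow, ofReal_norm] using this

/-- The energy away from a tubular neighbourhood of the singular set is bounded uniformly in the
width of the neighbourhood. -/
lemma setLIntegral_diff_thickening_le {n : ℕ} {R R' ρ : ℝ} (hρ : R' < ρ) (hρR : ρ < R)
    {S : Set (E n)} (hS : IsClosedSubmanifoldCodimGe2 S) {u : E n → ℝ}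
    (hu : ContDiffOn ℝ (⊤ : ℕ∞) u (ball (0 : E n) R \ S))
    (hΔ : ∀ x ∈ ball (0 : E n) R \ S, 0 ≤ elaplacian u x)
    (hb : ∀ x ∈ ball (0 : E n) R \ S, 0 ≤ u x ∧ u x ≤ 1) {δ : ℝ} (hδ : 0 < δ) :
    ∫⁻ x in ball (0 : E n) R' \ thickening δ S, ‖fderiv ℝ u x‖ₑ ^ 2 ≤
      4 * (2 * (ENNReal.ofReal ((ρ - R')⁻¹ ^ 2) * volume (closedBall (0 : E n) ρ)) + 2 * 1) := by
  obtain ⟨𝒦, h𝒦, hquad, hU⟩ := hS.exists_countable_quadraticTubes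
  have := h𝒦.to_subtype
  have hU' : ⋃ K : 𝒦, (K : Set (E n)) = S := by rw [← hU, Set.sUnion_eq_iUnion]
  have hTc : IsCompact (S ∩ closedBall 0 ρ) := (isCompact_closedBall _ _).inter_left hS.1
  obtain ⟨χ, M, W, hχ, hχ01, hWo, hTW, hW1, hsupp, hint⟩ :=
    exists_cutoff_of_countable_cover (K := fun K : 𝒦 => (K : Set (E n)))
      (fun K => (hquad K K.2).hasZeroCapacity) hTc
      (by rw [hU']; exact Set.inter_subset_left) hδ (one_ne_zero)
  rw [hU'] at hsupp
  have hη := lipschitzWith_radialCutoff (n := n) hρ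
  have hη01 := radialCutoff_mem_Icc (n := n) R' ρ
  have h1χ : LipschitzWith (0 + M) (fun x => 1 - χ x) := (LipschitzWith.const 1).sub hχ
  obtain ⟨L, hψ⟩ := exists_lipschitzWith_mul (A := 1) (B := 1) hη h1χ
    (fun x => abs_le.2 ⟨by linarith [(hη01 x).1], (hη01 x).2⟩)
    (fun x => abs_le.2 ⟨by linarith [(hχ01 x).2], by linarith [(hχ01 x).1]⟩)
  set ψ : E n → ℝ := fun x => radialCutoff R' ρ x * (1 - χ x) with hψdef
  have hψsupp : tsupport ψ ⊆ closedBall 0 ρ ∩ Wᶜ := by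
    refine closure_minimal (fun x hx => ⟨?_, fun hxW => ?_⟩)
      (isClosed_closedBall.inter hWo.isClosed_compl)
    · exact tsupport_radialCutoff_subset hρ (subset_tsupport _ (left_ne_zero_of_mul hx))
    · exact right_ne_zero_of_mul hx (by simp [hW1 x hxW])
  have hψc : HasCompactSupport ψ :=
    (isCompact_closedBall (0 : E n) ρ).of_isClosed_subset (isClosed_tsupport _)
      (hψsupp.trans Set.inter_subset_left)
  calc _ ≤ 4 * ∫⁻ x, ‖fderiv ℝ ψ x‖ₑ ^ 2 := by
        refine setLIntegral_enorm_fderiv_sq_le (isOpen_ball.sdiff hS.1) hu hΔ hb hψ hψc ?_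
          (measurableSet_ball.diff isOpen_thickening.measurableSet) ?_
        · intro x hx
          obtain ⟨hxρ, hxW⟩ := hψsupp hx
          exact ⟨closedBall_subset_ball hρR hxρ, fun hxS => hxW (hTW ⟨hxS, hxρ⟩)⟩
        · rintro x ⟨hxR, hxS⟩
          have : ‖x‖ ≤ R' := (mem_ball_zero_iff.1 hxR).le
          simp [hψdef, hsupp x hxS, radialCutoff_eq_one hρ this]
    _ ≤ 4 * (2 * (∫⁻ x, ‖fderiv ℝ (radialCutoff R' ρ : E n → ℝ) x‖ₑ ^ 2) +
          2 * ∫⁻ x, ‖fderiv ℝ χ x‖ₑ ^ 2) := by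
        gcongr
        exact lintegral_enorm_fderiv_mul_one_sub_sq_le hη hχ hη01 hχ01
    _ ≤ _ := by
        gcongr
        exact lintegral_enorm_fderiv_radialCutoff_sq_le hρ

lemma setLIntegral_ball_le {n : ℕ} {R' : ℝ} {S : Set (E n)} (hS : IsClosed S)
    (hS0 : volume S = 0) (g : E n → ℝ≥0∞) {C : ℝ≥0∞}
    (h : ∀ δ : ℝ, 0 < δ → ∫⁻ x in ball (0 : E n) R' \ thickening δ S, g x ≤ C) :
    ∫⁻ x in ball (0 : E n) R', g x ≤ C := by
  have hU : ⋃ k : ℕ, ball (0 : E n) R' \ thickening (1 / ((k : ℝ) + 1)) S =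
      ball (0 : E n) R' \ S := by
    rw [← Set.sdiff_iInter]
    congr 1
    refine Set.Subset.antisymm (fun x hx => ?_)
      (Set.subset_iInter fun k => self_subset_thickening (by positivity) S)
    rw [← hS.closure_eq, closure_eq_iInter_thickening]
    refine Set.mem_iInter₂.2 fun δ hδ => ?_
    obtain ⟨k, hk⟩ := exists_nat_one_div_lt hδ
    exact thickening_mono hk.le S (Set.mem_iInter.1 hx k)
  rw [← setLIntegral_congr (sdiff_null_ae_eq_self hS0), ← hU, setLIntegral_iUnion_of_directed]
  · exact iSup_le fun k => h _ (by positivity)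
  · refine Monotone.directed_le fun i j hij => ?_
    refine Set.sdiff_subset_sdiff_right (thickening_mono ?_ S)
    gcongr

/-- If `u ∈ C^∞(closure B_R \ Σ)` satisfies `Δu ≥ 0` and `0 ≤ u ≤ 1` on `B_R \ Σ`,
where `Σ` is a smooth closed submanifold of codimension `≥ 2`, then for any
`R' < R` one has `∫_{B_{R'}} |∇u|² ≤ C` with `C = C(n, R, R')` only. -/
theorem energy_bound_subharmonic_codim2 (n : ℕ) (R R' : ℝ) (hR' : 0 < R') (hRR' : R' < R) :
    ∃ C : ℝ, ∀ (S : Set (E n)), IsClosedSubmanifoldCodimGe2 S →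
      ∀ u : E n → ℝ,
        ContDiffOn ℝ (⊤ : ℕ∞) u (closure (ball (0 : E n) R) \ S) →
        (∀ x ∈ ball (0 : E n) R \ S, 0 ≤ elaplacian u x) →
        (∀ x ∈ ball (0 : E n) R \ S, 0 ≤ u x ∧ u x ≤ 1) →
        IntegrableOn (fun x => ‖gradient u x‖ ^ 2) (ball (0 : E n) R') volume ∧
        ∫ x in ball (0 : E n) R', ‖gradient u x‖ ^ 2 ≤ C := by
  obtain ⟨ρ, hρ, hρR⟩ := exists_between hRR'
  set C : ℝ≥0∞ :=
    4 * (2 * (ENNReal.ofReal ((ρ - R')⁻¹ ^ 2) * volume (closedBall (0 : E n) ρ)) + 2 * 1) with hC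
  have hCt : C ≠ ∞ := by
    have : volume (closedBall (0 : E n) ρ) ≠ ∞ := measure_closedBall_lt_top.ne
    rw [hC]
    finiteness
  refine ⟨C.toReal, fun S hS u hu hΔ hb => ?_⟩
  have hS0 : volume S = 0 := by
    obtain ⟨𝒦, h𝒦, hquad, hU⟩ := hS.exists_countable_quadraticTubes
    rw [← hU, measure_sUnion_null_iff h𝒦]
    exact fun K hK => (hquad K hK).volume_eq_zero
  have hle : ∫⁻ x in ball (0 : E n) R', ‖fderiv ℝ u x‖ₑ ^ 2 ≤ C :=
    setLIntegral_ball_le hS.1 hS0 _ fun δ hδ => setLIntegral_diff_thickening_le hρ hρR hS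
      (hu.mono (Set.sdiff_subset_sdiff_left subset_closure)) hΔ hb hδ
  have hgrad : (fun x => ‖gradient u x‖ ^ 2) = fun x => ‖fderiv ℝ u x‖ ^ 2 := by
    ext x
    rw [gradient, LinearIsometryEquiv.norm_map]
  have hof : ∀ x, ENNReal.ofReal (‖fderiv ℝ u x‖ ^ 2) = ‖fderiv ℝ u x‖ₑ ^ 2 := fun x => by
    rw [ENNReal.ofReal_pow (norm_nonneg _), ofReal_norm]
  have hmeas : Measurable fun x => ‖fderiv ℝ u x‖ ^ 2 := (measurable_fderiv ℝ u).norm.pow_const 2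
  rw [hgrad]
  constructor
  · refine ⟨hmeas.aestronglyMeasurable, ?_⟩
    rw [hasFiniteIntegral_iff_ofReal (ae_of_all _ fun x => by positivity)]
    simp only [hof]
    exact hle.trans_lt hCt.lt_top
  · rw [integral_eq_lintegral_of_nonneg_ae (ae_of_all _ fun x => by positivity)
      hmeas.aestronglyMeasurable]
    simp only [hof]
    exact ENNReal.toReal_mono hCt hle
end
end

section
/- Let B ⊂ ℝⁿ be a ball and Σ ⊂ ℝⁿ a smooth closed submanifold of codimension at least 2. If u ∈ C^∞(closure(B) \ Σ) satisfies Δu ≥ 0 and 0 ≤ u ≤ 1 on B \ Σ, then sup over B \ Σ of u is at most sup over ∂B \ Σ of u; i.e., the maximum principle holds despite the singular set Σ. -/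
open MeasureTheory Metric

noncomputable section

/-- `w` is continuous, has second partial derivatives along the coordinate axes everywhere, and
their sum is at most `c`. -/
def LaplacianLE {n : ℕ} (w : E n → ℝ) (c : ℝ) : Prop :=
  Continuous w ∧ ∃ w' w'' : Fin n → E n → ℝ,
    (∀ i x, HasLineDerivAt ℝ w (w' i x) x (EuclideanSpace.single i 1)) ∧
    (∀ i x, HasLineDerivAt ℝ (w' i) (w'' i x) x (EuclideanSpace.single i 1)) ∧
    ∀ x, ∑ i, w'' i x ≤ c

namespace LaplacianLE

variable {n : ℕ}

theorem zero : LaplacianLE (fun _ : E n => 0) 0 :=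
  ⟨continuous_const, fun _ _ => 0, fun _ _ => 0, fun _ _ => hasDerivAt_const _ _,
    fun _ _ => hasDerivAt_const _ _, fun _ => by simp⟩

theorem add {w₁ w₂ : E n → ℝ} {c₁ c₂ : ℝ} (h₁ : LaplacianLE w₁ c₁) (h₂ : LaplacianLE w₂ c₂) :
    LaplacianLE (fun x => w₁ x + w₂ x) (c₁ + c₂) := by
  obtain ⟨k₁, a₁, b₁, ha₁, hb₁, s₁⟩ := h₁
  obtain ⟨k₂, a₂, b₂, ha₂, hb₂, s₂⟩ := h₂
  refine ⟨k₁.add k₂, fun i x => a₁ i x + a₂ i x, fun i x => b₁ i x + b₂ i x,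
    fun i x => HasDerivAt.add (ha₁ i x) (ha₂ i x), fun i x => HasDerivAt.add (hb₁ i x) (hb₂ i x),
    fun x => ?_⟩
  rw [Finset.sum_add_distrib]
  exact add_le_add (s₁ x) (s₂ x)

theorem const_mul {w : E n → ℝ} {c a : ℝ} (h : LaplacianLE w c) (ha : 0 ≤ a) :
    LaplacianLE (fun x => a * w x) (a * c) := by
  obtain ⟨k, w', w'', h', h'', hs⟩ := h
  refine ⟨continuous_const.mul k, fun i x => a * w' i x, fun i x => a * w'' i x,
    fun i x => HasDerivAt.const_mul a (h' i x), fun i x => HasDerivAt.const_mul a (h'' i x),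
    fun x => ?_⟩
  rw [← Finset.mul_sum]
  exact mul_le_mul_of_nonneg_left (hs x) ha

theorem sum {ι : Type*} (t : Finset ι) {w : ι → E n → ℝ} (h : ∀ i ∈ t, LaplacianLE (w i) 0) :
    LaplacianLE (fun x => ∑ i ∈ t, w i x) 0 := by
  classical
  induction t using Finset.induction_on with
  | empty => simpa using zero
  | insert i t hi ih =>
    simp only [Finset.sum_insert hi]
    simpa using (h i (Finset.mem_insert_self _ _)).add
      (ih fun j hj => h j (Finset.mem_insert_of_mem hj))

theorem radial {φ φ' φ'' : ℝ → ℝ} {c s : ℝ} (hs : 0 < s) (p : E n)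
    (h' : ∀ t, 0 < t → HasDerivAt φ (φ' t) t) (h'' : ∀ t, 0 < t → HasDerivAt φ' (φ'' t) t)
    (hpos : ∀ t, 0 < t → 0 ≤ φ'' t) (hc : ∀ t, 0 < t → 2 * n * φ' t + 4 * t * φ'' t ≤ c) :
    LaplacianLE (fun x : E n => φ (‖x - p‖ ^ 2 + s ^ 2)) c := by
  have hρ : ∀ x : E n, 0 < ‖x - p‖ ^ 2 + s ^ 2 := fun x => by positivity
  have hline : ∀ (i : Fin n) (x : E n), HasLineDerivAt ℝ (fun x : E n => ‖x - p‖ ^ 2 + s ^ 2)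
      (2 * (x i - p i)) x (EuclideanSpace.single i 1) := fun i x => by
    have h1 := (((hasFDerivAt_id x).sub_const p).norm_sq.add_const (s ^ 2)).hasLineDerivAt
      (EuclideanSpace.single i (1 : ℝ))
    simpa [EuclideanSpace.inner_single_right] using h1
  have hcoord : ∀ (i : Fin n) (x : E n), HasLineDerivAt ℝ (fun x : E n => 2 * (x i - p i))
      2 x (EuclideanSpace.single i 1) := fun i x => by
    have h1 : HasDerivAt (fun t : ℝ => 2 * (x i + t - p i)) (2 * 1) 0 :=
      (((hasDerivAt_id (0 : ℝ)).const_add (x i)).sub_const (p i)).const_mul 2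
    simpa [HasLineDerivAt] using h1
  refine ⟨?_, fun i x => φ' (‖x - p‖ ^ 2 + s ^ 2) * (2 * (x i - p i)),
    fun i x => φ'' (‖x - p‖ ^ 2 + s ^ 2) * (2 * (x i - p i)) * (2 * (x i - p i)) +
      φ' (‖x - p‖ ^ 2 + s ^ 2) * 2, ?_, ?_, ?_⟩
  · refine continuous_iff_continuousAt.2 fun x => ?_
    refine ContinuousAt.comp (f := fun x : E n => ‖x - p‖ ^ 2 + s ^ 2) (g := φ)
      (h' _ (hρ x)).continuousAt (by fun_prop)
  · intro i x
    refine HasDerivAt.comp (h₂ := φ) (0 : ℝ) ?_ (hline i x)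
    simpa using h' _ (hρ x)
  · intro i x
    have h1 := HasDerivAt.comp (h₂ := φ') (h₂' := φ'' (‖x - p‖ ^ 2 + s ^ 2)) (0 : ℝ)
      (by simpa using h'' _ (hρ x)) (hline i x)
    simpa [HasLineDerivAt] using! HasDerivAt.mul h1 (hcoord i x)
  · intro x
    have hn : ∑ i, (x i - p i) ^ 2 = ‖x - p‖ ^ 2 := by
      simp [EuclideanSpace.norm_sq_eq]
    have : ∑ i, (φ'' (‖x - p‖ ^ 2 + s ^ 2) * (2 * (x i - p i)) * (2 * (x i - p i)) +
        φ' (‖x - p‖ ^ 2 + s ^ 2) * 2) =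
        4 * φ'' (‖x - p‖ ^ 2 + s ^ 2) * ‖x - p‖ ^ 2 + 2 * n * φ' (‖x - p‖ ^ 2 + s ^ 2) := by
      rw [Finset.sum_add_distrib, ← hn, Finset.mul_sum]
      simp only [Finset.sum_const, Finset.card_univ, Fintype.card_fin, nsmul_eq_mul]
      congr 1
      · exact Finset.sum_congr rfl fun i _ => by ring
      · ring
    rw [this]
    have h1 := hc _ (hρ x)
    have h2 := hpos _ (hρ x)
    nlinarith [mul_nonneg h2 (sq_nonneg s)]

end LaplacianLE

/-- The regularised Newtonian kernel `(‖x - p‖² + s²)^(-m/2)`. -/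
def newtonKernel {n : ℕ} (m : ℕ) (s : ℝ) (p x : E n) : ℝ :=
  (‖x - p‖ ^ 2 + s ^ 2) ^ (-(m / 2 : ℝ))

theorem newtonKernel_nonneg {n m : ℕ} {s : ℝ} (p x : E n) : 0 ≤ newtonKernel m s p x := by
  unfold newtonKernel; positivity

theorem newtonKernel_le {n m : ℕ} {s r : ℝ} {p x : E n} (hr : 0 < r) (h : r ≤ ‖x - p‖) :
    newtonKernel m s p x ≤ (r ^ 2) ^ (-(m / 2 : ℝ)) := by
  refine Real.rpow_le_rpow_of_nonpos (by positivity) ?_ (by simp; positivity)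
  nlinarith [sq_nonneg s]

theorem le_newtonKernel {n m : ℕ} {s ℓ A : ℝ} {p x : E n} (hs : 0 < s) (hsl : s ≤ ℓ)
    (h : ‖x - p‖ ≤ A * ℓ) :
    (A ^ 2 + 1) ^ (-(m / 2 : ℝ)) * (ℓ ^ m)⁻¹ ≤ newtonKernel m s p x := by
  have hl : 0 < ℓ := hs.trans_le hsl
  have h1 : (ℓ ^ m)⁻¹ = (ℓ ^ 2) ^ (-(m / 2 : ℝ)) := by
    rw [Real.rpow_neg (by positivity), ← Real.rpow_natCast ℓ 2, ← Real.rpow_mul hl.le,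
      ← Real.rpow_natCast ℓ m]
    congr 2
    push_cast
    ring
  rw [h1, ← Real.mul_rpow (by positivity) (by positivity)]
  refine Real.rpow_le_rpow_of_nonpos (by positivity) ?_ (by simp; positivity)
  have := pow_le_pow_left₀ (norm_nonneg _) h 2
  have := pow_le_pow_left₀ hs.le hsl 2
  nlinarith

theorem laplacianLE_newtonKernel {m : ℕ} {s : ℝ} (hs : 0 < s) (p : E (m + 2)) :
    LaplacianLE (newtonKernel m s p) 0 := by
  refine LaplacianLE.radial (φ := fun t => t ^ (-(m / 2 : ℝ)))
    (φ' := fun t => -(m / 2 : ℝ) * t ^ (-(m / 2 : ℝ) - 1))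
    (φ'' := fun t => -(m / 2 : ℝ) * ((-(m / 2 : ℝ) - 1) * t ^ (-(m / 2 : ℝ) - 1 - 1))) hs p
    (fun t ht => Real.hasDerivAt_rpow_const (Or.inl ht.ne'))
    (fun t ht => (Real.hasDerivAt_rpow_const (Or.inl ht.ne')).const_mul _)
    (fun t ht => ?_) (fun t ht => ?_)
  · have : 0 ≤ (m / 2 : ℝ) * ((m / 2 : ℝ) + 1) * t ^ (-(m / 2 : ℝ) - 1 - 1) := by positivity
    linarith
  · have : t ^ (-(m / 2 : ℝ) - 1) = t * t ^ (-(m / 2 : ℝ) - 1 - 1) := by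
      rw [Real.rpow_sub_one ht.ne' (-(m / 2 : ℝ) - 1)]
      field_simp
    rw [this]
    push_cast
    apply le_of_eq
    ring

theorem laplacianLE_log {s : ℝ} (hs : 0 < s) (p : E 2) (C : ℝ) :
    LaplacianLE (fun x => C - Real.log (‖x - p‖ ^ 2 + s ^ 2)) 0 := by
  refine LaplacianLE.radial (φ := fun t => C - Real.log t) (φ' := fun t => -t⁻¹)
    (φ'' := fun t => (t ^ 2)⁻¹) hs p
    (fun t ht => (Real.hasDerivAt_log ht.ne').const_sub C)
    (fun t ht => ?_) (fun t ht => by positivity) (fun t ht => ?_)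
  · simpa using (hasDerivAt_inv ht.ne').fun_neg
  · apply le_of_eq
    push_cast
    field_simp
    ring

theorem laplacianLE_neg_norm_sq (n : ℕ) (C : ℝ) :
    LaplacianLE (fun x : E n => C - ‖x‖ ^ 2) (-(2 * n)) := by
  have := LaplacianLE.radial (n := n) (φ := fun t => (C + 1) - t) (φ' := fun _ => -1)
    (φ'' := fun _ => 0) (c := -(2 * n)) one_pos 0
    (fun t _ => (hasDerivAt_id t).const_sub (C + 1)) (fun t _ => hasDerivAt_const _ _)
    (fun _ _ => le_rfl) (fun _ _ => by simp)
  simpa [add_sub_add_right_eq_sub] using this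

/-- A closed sup-norm cube is covered by its `2 ^ m` dyadic subcubes. -/
theorem exists_dyadic_subcubes {m : ℕ} (c : Fin m → ℝ) {ℓ : ℝ} (hl : 0 < ℓ) :
    ∃ c' : (Fin m → Bool) → (Fin m → ℝ),
      (∀ ε, closedBall (c' ε) (ℓ / 2) ⊆ closedBall c ℓ) ∧
      ∀ y ∈ closedBall c ℓ, ∃ ε, y ∈ closedBall (c' ε) (ℓ / 2) := by
  refine ⟨fun ε i => c i + if ε i then ℓ / 2 else -(ℓ / 2), fun ε => ?_, fun y hy => ?_⟩
  · refine closedBall_subset_closedBall' ?_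
    have : dist (fun i => c i + if ε i then ℓ / 2 else -(ℓ / 2)) c ≤ ℓ / 2 := by
      refine (dist_pi_le_iff (by positivity)).2 fun i => ?_
      rw [Real.dist_eq, abs_le]
      split_ifs <;> constructor <;> linarith
    linarith
  · rw [mem_closedBall, dist_pi_le_iff hl.le] at hy
    refine ⟨fun i => decide (c i ≤ y i), (dist_pi_le_iff (by positivity)).2 fun i => ?_⟩
    have h := hy i
    rw [Real.dist_eq, abs_le] at h ⊢
    by_cases hi : c i ≤ y i
    · simp only [hi, decide_true, if_true]
      constructor <;> linarith
    · simp only [hi, decide_false, Bool.false_eq_true, if_false]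
      constructor <;> linarith

/-- Averages of Newtonian kernels over a dyadic grid in an `m`-dimensional Lipschitz cube grow
linearly in the depth of the grid, up to scale. -/
theorem exists_dyadic_potential {m : ℕ} (hm : 0 < m) {g : (Fin m → ℝ) → E (m + 2)} {L s : ℝ}
    (hL : 0 ≤ L) (hs : 0 < s) (N : ℕ) : ∀ (c : Fin m → ℝ) (ℓ : ℝ),
    (∀ y ∈ closedBall c ℓ, ∀ z ∈ closedBall c ℓ, ‖g y - g z‖ ≤ L * ‖y - z‖) →
    s * 2 ^ N ≤ ℓ → ∃ w : E (m + 2) → ℝ, LaplacianLE w 0 ∧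
      (∀ x b, (∀ z ∈ closedBall c ℓ, b ≤ newtonKernel m s (g z) x) → b ≤ w x) ∧
      (∀ x b, (∀ z ∈ closedBall c ℓ, newtonKernel m s (g z) x ≤ b) → w x ≤ b) ∧
      ∀ y ∈ closedBall c ℓ,
        ((2 * L) ^ 2 + 1) ^ (-(m / 2 : ℝ)) * (ℓ ^ m)⁻¹ * (1 + N / 2) ≤ w (g y) := by
  have hkey : ∀ (c : Fin m → ℝ) (ℓ : ℝ), s ≤ ℓ →
      (∀ y ∈ closedBall c ℓ, ∀ z ∈ closedBall c ℓ, ‖g y - g z‖ ≤ L * ‖y - z‖) →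
      ∀ y ∈ closedBall c ℓ, ∀ z ∈ closedBall c ℓ,
        ((2 * L) ^ 2 + 1) ^ (-(m / 2 : ℝ)) * (ℓ ^ m)⁻¹ ≤ newtonKernel m s (g z) (g y) := by
    intro c ℓ hsl hg y hy z hz
    refine le_newtonKernel hs hsl ((hg y hy z hz).trans ?_)
    have : ‖y - z‖ ≤ 2 * ℓ := by
      rw [← dist_eq_norm]
      linarith [dist_triangle_right y z c, mem_closedBall.1 hy, mem_closedBall.1 hz]
    nlinarith
  induction N with
  | zero =>
    intro c ℓ hg hsl
    rw [pow_zero, mul_one] at hsl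
    have hl : 0 < ℓ := hs.trans_le hsl
    have hc : c ∈ closedBall c ℓ := mem_closedBall_self hl.le
    refine ⟨newtonKernel m s (g c), laplacianLE_newtonKernel hs _, fun x b h => h c hc,
      fun x b h => h c hc, fun y hy => ?_⟩
    simpa using hkey c ℓ hsl hg y hy c hc
  | succ N ih =>
    intro c ℓ hg hsl
    have h2N : (1 : ℝ) ≤ 2 ^ N := one_le_pow₀ (by norm_num)
    have hsl' : s * 2 ^ N ≤ ℓ / 2 := by rw [pow_succ] at hsl; linarith
    have hsl1 : s ≤ ℓ := by nlinarith
    have hl : 0 < ℓ := hs.trans_le hsl1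
    obtain ⟨c', hsub, hcov⟩ := exists_dyadic_subcubes c hl
    choose w hw hlow hup hdiag using fun ε => ih (c' ε) (ℓ / 2)
      (fun y hy z hz => hg y (hsub ε hy) z (hsub ε hz)) hsl'
    have hcard : ((Finset.univ : Finset (Fin m → Bool)).card : ℝ) = 2 ^ m := by simp
    have h2m : (0 : ℝ) < 2 ^ m := by positivity
    refine ⟨fun x => (2 ^ m)⁻¹ * ∑ ε, w ε x, ?_, fun x b h => ?_, fun x b h => ?_, fun y hy => ?_⟩
    · simpa using (LaplacianLE.sum Finset.univ fun ε _ => hw ε).const_mul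
        (a := (2 ^ m)⁻¹) (by positivity)
    · beta_reduce
      rw [inv_mul_eq_div, le_div_iff₀' h2m, ← hcard, ← nsmul_eq_mul]
      exact Finset.card_nsmul_le_sum _ _ _ fun ε _ => hlow ε x b fun z hz => h z (hsub ε hz)
    · beta_reduce
      rw [inv_mul_eq_div, div_le_iff₀' h2m, ← hcard, ← nsmul_eq_mul]
      exact Finset.sum_le_card_nsmul _ _ _ fun ε _ => hup ε x b fun z hz => h z (hsub ε hz)
    · obtain ⟨ε₀, hε₀⟩ := hcov y hy
      set a : ℝ := ((2 * L) ^ 2 + 1) ^ (-(m / 2 : ℝ)) * (ℓ ^ m)⁻¹ with ha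
      have ha0 : 0 ≤ a := by positivity
      have h1 : 2 ^ m * (a * (1 + N / 2)) ≤ w ε₀ (g y) := by
        refine le_of_eq_of_le ?_ (hdiag ε₀ y hε₀)
        rw [ha, div_pow]
        field_simp
      have h2 : ((2 : ℝ) ^ m - 1) * a ≤ ∑ ε ∈ Finset.univ.erase ε₀, w ε (g y) := by
        have hc : ((Finset.univ.erase ε₀).card : ℝ) = 2 ^ m - 1 := by
          rw [Finset.card_erase_of_mem (Finset.mem_univ _), Nat.cast_sub, hcard, Nat.cast_one]
          exact Finset.card_pos.2 ⟨ε₀, Finset.mem_univ _⟩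
        rw [← hc, ← nsmul_eq_mul]
        exact Finset.card_nsmul_le_sum _ _ _ fun ε _ => hlow ε _ _ fun z hz =>
          hkey c ℓ hsl1 hg y hy z (hsub ε hz)
      have h3 : (2 : ℝ) ≤ 2 ^ m := le_self_pow₀ (by norm_num) hm.ne'
      beta_reduce
      rw [inv_mul_eq_div, le_div_iff₀' h2m,
        ← Finset.add_sum_erase _ (fun ε => w ε (g y)) (Finset.mem_univ ε₀)]
      push_cast
      nlinarith [mul_le_mul_of_nonneg_right h3 ha0]

/-- `A` is negligible seen from `x₀`: there are superharmonic functions, nonnegative on the ball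
of radius `R`, that exceed `1` on `A` and are arbitrarily small at `x₀`. -/
def NegligibleAt {n : ℕ} (R : ℝ) (x₀ : E n) (A : Set (E n)) : Prop :=
  ∀ δ : ℝ, 0 < δ → ∃ w : E n → ℝ, LaplacianLE w 0 ∧ (∀ x ∈ closedBall (0 : E n) R, 0 ≤ w x) ∧
    (∀ x ∈ A, 1 < w x) ∧ w x₀ ≤ δ

theorem negligibleAt_image_cube {m : ℕ} (hm : 0 < m) {g : (Fin m → ℝ) → E (m + 2)} {L ℓ r : ℝ}
    (R : ℝ) (x₀ : E (m + 2)) (c : Fin m → ℝ) (hL : 0 ≤ L) (hl : 0 < ℓ) (hr : 0 < r)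
    (hg : ∀ y ∈ closedBall c ℓ, ∀ z ∈ closedBall c ℓ, ‖g y - g z‖ ≤ L * ‖y - z‖)
    (hx : ∀ z ∈ closedBall c ℓ, r ≤ ‖x₀ - g z‖) :
    NegligibleAt R x₀ (g '' closedBall c ℓ) := by
  intro δ hδ
  set C : ℝ := (r ^ 2) ^ (-(m / 2 : ℝ)) with hC
  have hC0 : 0 < C := by positivity
  set a : ℝ := ((2 * L) ^ 2 + 1) ^ (-(m / 2 : ℝ)) * (ℓ ^ m)⁻¹ with ha
  have ha0 : 0 < a := by positivity
  obtain ⟨N, hN⟩ := exists_nat_gt (2 * (C / (δ * a)))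
  obtain ⟨w, hw, hlow, hup, hdiag⟩ := exists_dyadic_potential hm hL
    (s := ℓ / 2 ^ N) (by positivity) N c ℓ hg (by field_simp; rfl)
  refine ⟨fun x => δ / C * w x, by simpa using hw.const_mul (a := δ / C) (by positivity),
    fun x _ => mul_nonneg (by positivity) (hlow x 0 fun z _ => newtonKernel_nonneg _ _), ?_, ?_⟩
  · rintro _ ⟨y, hy, rfl⟩
    have h1 := hdiag y hy
    beta_reduce
    rw [div_mul_eq_mul_div, one_lt_div hC0]
    have h2 : C / (δ * a) < 1 + N / 2 := by linarith
    rw [div_lt_iff₀ (by positivity)] at h2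
    calc C < (1 + N / 2) * (δ * a) := h2
      _ = δ * (a * (1 + N / 2)) := by ring
      _ ≤ δ * w (g y) := by gcongr
  · have h1 : w x₀ ≤ C := hup x₀ C fun z hz => newtonKernel_le hr (hx z hz)
    beta_reduce
    rw [div_mul_eq_mul_div, div_le_iff₀ hC0]
    gcongr

theorem negligibleAt_singleton {R : ℝ} {x₀ p : E 2} (hx : p ≠ x₀)
    (hx₀ : x₀ ∈ closedBall (0 : E 2) R) : NegligibleAt R x₀ {p} := by
  intro δ hδ
  have hr : 0 < ‖x₀ - p‖ := norm_pos_iff.2 (sub_ne_zero.2 hx.symm)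
  set D : ℝ := Real.log ((R + ‖p‖) ^ 2 + 1) with hD
  have hR : 0 ≤ R := (norm_nonneg _).trans (mem_closedBall_zero_iff.1 hx₀)
  set T : ℝ := max 1 (D - Real.log (‖x₀ - p‖ ^ 2)) with hT
  have hT0 : 0 < T := lt_of_lt_of_le one_pos (le_max_left _ _)
  set s : ℝ := min 1 (Real.exp ((D - T / δ - 1) / 2)) with hs
  have hs0 : 0 < s := lt_min one_pos (Real.exp_pos _)
  refine ⟨fun x => δ / T * (D - Real.log (‖x - p‖ ^ 2 + s ^ 2)),
    by simpa using (laplacianLE_log hs0 p D).const_mul (a := δ / T) (by positivity), ?_, ?_, ?_⟩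
  · intro x hx
    refine mul_nonneg (by positivity) (sub_nonneg.2 (Real.log_le_log (by positivity) ?_))
    have h1 : ‖x - p‖ ≤ R + ‖p‖ := (norm_sub_le _ _).trans
      (by gcongr; exact mem_closedBall_zero_iff.1 hx)
    have h2 : s ^ 2 ≤ 1 := pow_le_one₀ hs0.le (min_le_left _ _)
    gcongr
  · rintro x rfl
    have h1 : Real.log (s ^ 2) ≤ D - T / δ - 1 := by
      rw [Real.log_pow]
      have := (Real.log_le_iff_le_exp hs0).2 (min_le_right 1 (Real.exp ((D - T / δ - 1) / 2)))
      push_cast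
      linarith
    have h2 : T / δ < D - Real.log (s ^ 2) := by linarith
    rw [div_lt_iff₀ hδ] at h2
    simp only [sub_self, norm_zero, ne_eq, OfNat.ofNat_ne_zero, not_false_eq_true, zero_pow,
      zero_add]
    rw [div_mul_eq_mul_div, one_lt_div hT0]
    linarith
  · have h1 : Real.log (‖x₀ - p‖ ^ 2) ≤ Real.log (‖x₀ - p‖ ^ 2 + s ^ 2) :=
      Real.log_le_log (by positivity) (by nlinarith)
    have h2 : D - Real.log (‖x₀ - p‖ ^ 2) ≤ T := le_max_right _ _
    beta_reduce
    rw [div_mul_eq_mul_div, div_le_iff₀ hT0]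
    gcongr
    linarith

theorem exists_nhds_negligibleAt_image {m : ℕ} {g : (Fin m → ℝ) → E (m + 2)} {R : ℝ}
    {x₀ : E (m + 2)} (hx₀ : x₀ ∈ closedBall (0 : E (m + 2)) R) {y : Fin m → ℝ}
    (hg : ContDiffAt ℝ 1 g y) (hy : g y ≠ x₀) : ∃ t ∈ nhds y, NegligibleAt R x₀ (g '' t) := by
  rcases Nat.eq_zero_or_pos m with rfl | hm
  · refine ⟨{y}, by simp, ?_⟩
    rw [Set.image_singleton]
    exact negligibleAt_singleton hy hx₀
  · obtain ⟨K, t, ht, hK⟩ := hg.exists_lipschitzOnWith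
    have hr : 0 < ‖x₀ - g y‖ := norm_pos_iff.2 (sub_ne_zero.2 hy.symm)
    have hev : ∀ᶠ z in nhds y, ‖x₀ - g y‖ / 2 < ‖x₀ - g z‖ :=
      (continuousAt_const.sub hg.continuousAt).norm.eventually (lt_mem_nhds (half_lt_self hr))
    obtain ⟨ℓ, hl, hsub⟩ := nhds_basis_closedBall.mem_iff.1 (Filter.inter_mem ht hev)
    refine ⟨_, closedBall_mem_nhds y hl, negligibleAt_image_cube hm R x₀ y K.coe_nonneg hl
      (half_pos hr) (fun a ha b hb => ?_) fun z hz => (hsub hz).2.le⟩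
    simpa [dist_eq_norm] using hK.dist_le_mul a (hsub ha).1 b (hsub hb).1

/-- A countable union of sets that are negligible seen from `x₀` covers `A`. -/
def SigmaNegligibleAt {n : ℕ} (R : ℝ) (x₀ : E n) (A : Set (E n)) : Prop :=
  ∃ T : Set (Set (E n)), T.Countable ∧ (∀ B ∈ T, NegligibleAt R x₀ B) ∧ A ⊆ ⋃₀ T

namespace SigmaNegligibleAt

variable {n : ℕ} {R : ℝ} {x₀ : E n}

theorem mono {A B : Set (E n)} (h : SigmaNegligibleAt R x₀ B) (hAB : A ⊆ B) :
    SigmaNegligibleAt R x₀ A :=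
  let ⟨T, hT, hn, hc⟩ := h
  ⟨T, hT, hn, hAB.trans hc⟩

theorem of_negligibleAt {A : Set (E n)} (h : NegligibleAt R x₀ A) : SigmaNegligibleAt R x₀ A :=
  ⟨{A}, Set.countable_singleton A, by simpa using h, by simp⟩

theorem sUnion {S : Set (Set (E n))} (hS : S.Countable)
    (h : ∀ A ∈ S, SigmaNegligibleAt R x₀ A) : SigmaNegligibleAt R x₀ (⋃₀ S) := by
  choose! T hT hn hc using h
  refine ⟨⋃ A ∈ S, T A, hS.biUnion hT, fun B hB => ?_, Set.sUnion_subset fun A hA => ?_⟩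
  · obtain ⟨A, hA, hB⟩ := Set.mem_iUnion₂.1 hB
    exact hn A hA B hB
  · exact (hc A hA).trans (Set.sUnion_subset_sUnion (Set.subset_biUnion_of_mem hA))

/-- It is enough to check countable coverability of an image locally in the source. -/
theorem image_of_locally {X : Type*} [TopologicalSpace X] [HereditarilyLindelofSpace X]
    {g : X → E n} {s : Set X} (h : ∀ y ∈ s, ∃ t ∈ nhdsWithin y s, SigmaNegligibleAt R x₀ (g '' t)) :
    SigmaNegligibleAt R x₀ (g '' s) := by
  refine (HereditarilyLindelofSpace.isLindelof s).induction_on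
    (p := fun t => SigmaNegligibleAt R x₀ (g '' t)) (fun a b hab hb => hb.mono (Set.image_mono hab))
    (fun S hS hn => ?_) h
  rw [Set.sUnion_eq_biUnion, Set.image_iUnion₂, ← Set.sUnion_image]
  exact sUnion (hS.image _) (by rintro _ ⟨t, ht, rfl⟩; exact hn t ht)

theorem negligibleAt_of_isCompact {K : Set (E n)} (h : SigmaNegligibleAt R x₀ K)
    (hK : IsCompact K) (hKR : K ⊆ closedBall 0 R) :
    NegligibleAt R x₀ K := by
  intro δ hδ
  obtain ⟨T, hT, hn, hc⟩ := h
  have := hT.to_subtype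
  obtain ⟨η, hη, c, hsum, hcδ⟩ :=
    NNReal.exists_pos_sum_of_countable (ε := ⟨δ, hδ.le⟩)
      (fun h => hδ.ne' (congrArg NNReal.toReal h)) T
  choose w hw hpos hone hle using fun B : T => hn B B.2 (η B) (hη B)
  obtain ⟨t, ht⟩ := hK.elim_finite_subcover (fun B : T => {x | 1 < w B x})
    (fun B => isOpen_lt continuous_const (hw B).1) (fun x hx => by
      obtain ⟨B, hB, hxB⟩ := hc hx
      exact Set.mem_iUnion.2 ⟨⟨B, hB⟩, hone ⟨B, hB⟩ x hxB⟩)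
  refine ⟨fun x => ∑ B ∈ t, w B x, LaplacianLE.sum t fun B _ => hw B,
    fun x hx => Finset.sum_nonneg fun B _ => hpos B x hx, fun x hx => ?_, ?_⟩
  · obtain ⟨B, hB, hxB⟩ := Set.mem_iUnion₂.1 (ht hx)
    exact lt_of_lt_of_le hxB
      (Finset.single_le_sum (f := fun B => w B x) (fun B _ => hpos B x (hKR hx)) hB)
  · calc ∑ B ∈ t, w B x₀ ≤ ∑ B ∈ t, (η B : ℝ) := Finset.sum_le_sum fun B _ => hle B
      _ ≤ (c : ℝ) := by
        exact_mod_cast sum_le_hasSum t (fun _ _ => zero_le) hsum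
      _ ≤ δ := by exact_mod_cast hcδ.le

end SigmaNegligibleAt

theorem sigmaNegligibleAt_image {n d : ℕ} (hd : d + 2 ≤ n) {R : ℝ} {x₀ : E n}
    (hx₀ : x₀ ∈ closedBall (0 : E n) R) {V s : Set (E d)} (hV : IsOpen V) {f : E d → E n}
    (hf : ContDiffOn ℝ (⊤ : ℕ∞) f V) (hs : s ⊆ V) (hfs : x₀ ∉ f '' s) :
    SigmaNegligibleAt R x₀ (f '' s) := by
  obtain ⟨m, rfl⟩ := Nat.exists_eq_add_of_le' ((Nat.le_add_left 2 d).trans hd)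
  have hdm : d ≤ m := by omega
  set π : (Fin m → ℝ) → E d := fun y => WithLp.toLp 2 fun i => y (Fin.castLE hdm i) with hπ
  have hπd : ContDiff ℝ 1 π := by
    refine (PiLp.contDiff_toLp (p := 2)).comp (contDiff_pi.2 fun i => ?_)
    exact contDiff_apply ℝ ℝ _
  have hsurj : Function.Surjective π := fun z =>
    ⟨fun j => if h : j.1 < d then z ⟨j, h⟩ else 0, by ext i; simp [hπ]⟩
  rw [← Set.image_preimage_eq s hsurj, ← Set.image_comp]
  refine SigmaNegligibleAt.image_of_locally fun y hy => ?_
  have hg : ContDiffAt ℝ 1 (f ∘ π) y :=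
    ((hf.contDiffAt (hV.mem_nhds (hs hy))).of_le (by exact_mod_cast le_top)).comp y
      hπd.contDiffAt
  obtain ⟨t, ht, hneg⟩ := exists_nhds_negligibleAt_image hx₀ hg
    (fun h => hfs ⟨π y, hy, h⟩)
  exact ⟨t, mem_nhdsWithin_of_mem_nhds ht, .of_negligibleAt hneg⟩

theorem IsClosedSubmanifoldCodimGe2.sigmaNegligibleAt {n : ℕ} {S : Set (E n)}
    (hS : IsClosedSubmanifoldCodimGe2 S) {R : ℝ} {x₀ : E n}
    (hx₀ : x₀ ∈ closedBall (0 : E n) R) (hxS : x₀ ∉ S) : SigmaNegligibleAt R x₀ S := by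
  obtain ⟨-, d, hd, hloc⟩ := hS
  rw [← Set.image_id S]
  refine SigmaNegligibleAt.image_of_locally fun x hx => ?_
  obtain ⟨V, f, U, hV, hU, hxU, hf, -, h⟩ := hloc x hx
  obtain ⟨s, hs, hfs⟩ : ∃ s ⊆ V, f '' s = S ∩ U := by
    rcases h with h | ⟨i, h⟩
    · exact ⟨V, subset_rfl, h⟩
    · exact ⟨_, fun y hy => hy.1, h⟩
  refine ⟨S ∩ U, inter_mem_nhdsWithin S (hU.mem_nhds hxU), ?_⟩
  rw [Set.image_id, ← hfs]
  exact sigmaNegligibleAt_image hd hx₀ hV hf hs fun h => hxS (hfs ▸ h).1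

theorem second_deriv_nonpos_of_isLocalMax {g g' : ℝ → ℝ} {a x : ℝ} (h : IsLocalMax g x)
    (hg : ∀ᶠ t in nhds x, HasDerivAt g (g' t) t) (hg' : HasDerivAt g' a x) : a ≤ 0 := by
  by_contra! ha
  have hd : deriv g =ᶠ[nhds x] g' := hg.mono fun t ht => ht.deriv
  have hmin : IsLocalMin g x := isLocalMin_of_deriv_deriv_pos
    (by rw [hd.deriv_eq, hg'.deriv]; exact ha) h.deriv_eq_zero hg.self_of_nhds.continuousAt
  have hconst : g =ᶠ[nhds x] fun _ => g x := by
    filter_upwards [h, hmin] with t h1 h2 using le_antisymm h1 h2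
  have h0 : g' =ᶠ[nhds x] fun _ => 0 := by
    filter_upwards [hconst.eventuallyEq_nhds, hd] with t h1 h2
    rw [← h2, h1.deriv_eq, deriv_const]
  have := hg'.unique ((hasDerivAt_const x (0 : ℝ)).congr_of_eventuallyEq h0)
  exact ha.ne' this

/-- At an interior local maximum of `u - w`, the Laplacian of `u` is at most that of `w`. -/
theorem elaplacian_le_of_isLocalMax_sub {n : ℕ} {u w : E n → ℝ} {c : ℝ} {x : E n}
    (hu : ContDiffAt ℝ 2 u x) (hw : LaplacianLE w c)
    (h : IsLocalMax (fun y => u y - w y) x) : elaplacian u x ≤ c := by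
  obtain ⟨-, w', w'', h', h'', hs⟩ := hw
  refine le_trans (Finset.sum_le_sum fun i _ => ?_) (hs x)
  set e : E n := EuclideanSpace.single i (1 : ℝ) with he
  have hline : Filter.Tendsto (fun t : ℝ => x + t • e) (nhds 0) (nhds x) := by
    have : Continuous fun t : ℝ => x + t • e := by fun_prop
    simpa using this.tendsto 0
  have hshift : ∀ {f : E n → ℝ} {a t : ℝ}, HasLineDerivAt ℝ f a (x + t • e) e →
      HasDerivAt (fun r : ℝ => f (x + r • e)) a t := fun {f a t} hf => by
    have h1 : HasDerivAt (fun r : ℝ => f (x + t • e + r • e)) a (t - t) := by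
      rw [sub_self]; exact hf
    have h2 := h1.comp_sub_const t t
    refine h2.congr_of_eventuallyEq (Filter.Eventually.of_forall fun r => ?_)
    simp only [sub_smul]
    congr 1
    abel
  have hud : ∀ᶠ y in nhds x, DifferentiableAt ℝ u y :=
    (hu.eventually (by simp)).mono fun y hy => hy.differentiableAt two_ne_zero
  have hu2 : DifferentiableAt ℝ (fun y => fderiv ℝ u y e) x :=
    ((hu.fderiv_right (m := 1) (by norm_num)).differentiableAt one_ne_zero).clm_apply
      (differentiableAt_const e)
  have hmax : IsLocalMax (fun t : ℝ => u (x + t • e) - w (x + t • e)) 0 := by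
    have := hline.eventually h
    simpa [IsLocalMax, IsMaxFilter] using this
  have hfirst : ∀ᶠ t in nhds (0 : ℝ), HasDerivAt (fun t : ℝ => u (x + t • e) - w (x + t • e))
      (fderiv ℝ u (x + t • e) e - w' i (x + t • e)) t := by
    filter_upwards [hline.eventually hud] with t ht
    exact (hshift (ht.hasFDerivAt.hasLineDerivAt e)).sub (hshift (h' i _))
  have := second_deriv_nonpos_of_isLocalMax hmax hfirst
    (HasDerivAt.sub (hu2.hasFDerivAt.hasLineDerivAt e) (h'' i x))
  linarith

theorem le_of_negligibleAt {n : ℕ} (hn : 0 < n) {R M : ℝ} {S : Set (E n)} (hS : IsClosed S)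
    {u : E n → ℝ} (hu : ContDiffOn ℝ 2 u (closedBall 0 R \ S))
    (hsub : ∀ x ∈ ball (0 : E n) R \ S, 0 ≤ elaplacian u x)
    (hle : ∀ x ∈ closedBall (0 : E n) R \ S, u x ≤ 1) (hM : 0 ≤ M)
    (hsphere : ∀ x ∈ sphere (0 : E n) R \ S, u x ≤ M) {x₀ : E n}
    (hx₀ : x₀ ∈ closedBall (0 : E n) R \ S)
    (hneg : NegligibleAt R x₀ (S ∩ closedBall 0 R)) : u x₀ ≤ M := by
  by_contra! hlt
  set δ : ℝ := (u x₀ - M) / 3 with hδ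
  have hδ0 : 0 < δ := by rw [hδ]; linarith
  obtain ⟨w₁, hw₁, hpos₁, hone₁, hx₁⟩ := hneg δ hδ0
  set η : ℝ := δ / (R ^ 2 + 1) with hη
  have hη0 : 0 < η := by positivity
  set w : E n → ℝ := fun x => w₁ x + η * (R ^ 2 - ‖x‖ ^ 2) with hwdef
  have hw : LaplacianLE w (0 + η * -(2 * n)) :=
    hw₁.add ((laplacianLE_neg_norm_sq n (R ^ 2)).const_mul hη0.le)
  have hq : ∀ x ∈ closedBall (0 : E n) R, 0 ≤ η * (R ^ 2 - ‖x‖ ^ 2) := fun x hx => by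
    refine mul_nonneg hη0.le (sub_nonneg.2 ?_)
    exact pow_le_pow_left₀ (norm_nonneg _) (mem_closedBall_zero_iff.1 hx) 2
  have hpos : ∀ x ∈ closedBall (0 : E n) R, 0 ≤ w x := fun x hx =>
    add_nonneg (hpos₁ x hx) (hq x hx)
  have hone : ∀ x ∈ S ∩ closedBall (0 : E n) R, 1 < w x := fun x hx => by
    have := hone₁ x hx
    have := hq x hx.2
    simp only [hwdef]
    linarith
  have hwx₀ : w x₀ ≤ 2 * δ := by
    have h1 : η * (R ^ 2 + 1) = δ := by rw [hη]; field_simp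
    have h2 : η * (R ^ 2 - ‖x₀‖ ^ 2) ≤ η * (R ^ 2 + 1) := by
      gcongr
      nlinarith [sq_nonneg ‖x₀‖]
    simp only [hwdef]
    linarith
  have hv₀ : M < u x₀ - w x₀ := by linarith
  set C : Set (E n) := closedBall 0 R ∩ {x | w x ≤ 1 - (u x₀ - w x₀)} with hC
  have hCc : IsCompact C :=
    (isCompact_closedBall _ _).inter_right (isClosed_le hw.1 continuous_const)
  have hCS : C ⊆ closedBall 0 R \ S := fun x hx => ⟨hx.1, fun hxS => by
    have := hone x ⟨hxS, hx.1⟩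
    have h2 : w x ≤ 1 - (u x₀ - w x₀) := hx.2
    linarith⟩
  have hx₀C : x₀ ∈ C := ⟨hx₀.1, by
    have := hle x₀ hx₀
    show w x₀ ≤ 1 - (u x₀ - w x₀)
    linarith⟩
  obtain ⟨x₁, hx₁C, hmaxC⟩ := hCc.exists_isMaxOn ⟨x₀, hx₀C⟩
    ((hu.continuousOn.mono hCS).sub hw.1.continuousOn)
  have hv₁ : u x₀ - w x₀ ≤ u x₁ - w x₁ := hmaxC hx₀C
  have hmax : ∀ x ∈ closedBall (0 : E n) R \ S, u x - w x ≤ u x₁ - w x₁ := fun x hx => by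
    by_cases hxC : x ∈ C
    · exact hmaxC hxC
    · have h1 : ¬ w x ≤ 1 - (u x₀ - w x₀) := fun h => hxC ⟨hx.1, h⟩
      have := hle x hx
      linarith
  have hx₁b : x₁ ∈ ball (0 : E n) R := by
    by_contra hnb
    have hs : x₁ ∈ sphere (0 : E n) R \ S :=
      ⟨le_antisymm hx₁C.1 (not_lt.1 hnb), (hCS hx₁C).2⟩
    linarith [hsphere x₁ hs, hpos x₁ hx₁C.1]
  have hnhds : closedBall (0 : E n) R \ S ∈ nhds x₁ :=
    Filter.mem_of_superset ((isOpen_ball.sdiff hS).mem_nhds ⟨hx₁b, (hCS hx₁C).2⟩)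
      (Set.sdiff_subset_sdiff_left ball_subset_closedBall)
  have h1 := elaplacian_le_of_isLocalMax_sub (hu.contDiffAt hnhds) hw
    (Filter.mem_of_superset hnhds hmax)
  have h2 := hsub x₁ ⟨hx₁b, (hCS hx₁C).2⟩
  have : 0 < η * (2 * n) := by positivity
  linarith

/-- the maximum principle holds for bounded subharmonic functions
despite a singular set `Σ` of codimension `≥ 2`:
`sup_{B \ Σ} u ≤ sup_{∂B \ Σ} u`. -/
theorem max_principle_codim2 (n : ℕ) (R : ℝ) (hR : 0 < R)
    (S : Set (E n)) (hS : IsClosedSubmanifoldCodimGe2 S)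
    (u : E n → ℝ)
    (hu : ContDiffOn ℝ (⊤ : ℕ∞) u (closure (ball (0 : E n) R) \ S))
    (hsub : ∀ x ∈ ball (0 : E n) R \ S, 0 ≤ elaplacian u x)
    (hbdd : ∀ x ∈ ball (0 : E n) R \ S, 0 ≤ u x ∧ u x ≤ 1) :
    ∀ x ∈ ball (0 : E n) R \ S, u x ≤ sSup (u '' (sphere (0 : E n) R \ S)) := by
  have hcl : closure (ball (0 : E n) R) = closedBall 0 R := closure_ball 0 hR.ne'
  have hbdd' : ∀ x ∈ closedBall (0 : E n) R \ S, u x ∈ Set.Icc 0 1 := fun x hx => by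
    have hxc : x ∈ closure (ball (0 : E n) R \ S) := by
      rw [Set.sdiff_eq, Set.inter_comm]
      exact hS.1.isOpen_compl.inter_closure ⟨hx.2, hcl ▸ hx.1⟩
    have hc : ContinuousWithinAt u (ball (0 : E n) R \ S) x :=
      (hu.continuousOn x ⟨hcl ▸ hx.1, hx.2⟩).mono (Set.sdiff_subset_sdiff_left subset_closure)
    exact isClosed_Icc.closure_subset (hc.mem_closure hxc fun y hy => hbdd y hy)
  rw [hcl] at hu
  have hss : sphere (0 : E n) R \ S ⊆ closedBall 0 R \ S :=
    Set.sdiff_subset_sdiff_left sphere_subset_closedBall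
  intro x hx
  have hx' : x ∈ closedBall (0 : E n) R \ S := ⟨ball_subset_closedBall hx.1, hx.2⟩
  have hn : 0 < n := by
    obtain ⟨-, d, hd, -⟩ := hS
    omega
  refine le_of_negligibleAt hn hS.1 (hu.of_le (WithTop.coe_le_coe.2 (le_top : (2 : ℕ∞) ≤ ⊤))) hsub
    (fun y hy => (hbdd' y hy).2) ?_ (fun y hy => ?_) hx' ?_
  · refine Real.sSup_nonneg ?_
    rintro _ ⟨y, hy, rfl⟩
    exact (hbdd' y (hss hy)).1
  · refine le_csSup ⟨1, ?_⟩ (Set.mem_image_of_mem u hy)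
    rintro _ ⟨z, hz, rfl⟩
    exact (hbdd' z (hss hz)).2
  · exact ((hS.sigmaNegligibleAt hx'.1 hx.2).mono Set.inter_subset_left).negligibleAt_of_isCompact
      ((isCompact_closedBall _ _).inter_left hS.1) Set.inter_subset_right
end
end
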